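/- arXiv:1202.6129 — 2 statements merged into one kernel-verified Lean document; each statement's English description precedes it below -/
import Mathlib

section
/- Let G be an acyclically edge (Δ(G)+2)-critical finite simple graph, and let v be a vertex of degree 3 with neighbors x, y, z. If x has degree 4, then, after possibly swapping the labels of y and z, the vertex y is adjacent to at least three vertices of degree at least 4, the vertex z is adjacent to at least two vertices of degree at least 4, and moreover if z has degree exactly 5 then z is adjacent to at least three vertices of degree at least 4. -/
open SimpleGraph

/-- A proper edge coloring of `G`: distinct edges sharing a vertex get distinct colors. -/
def IsProperEdgeColoring {V : Type*} {α : Type*} (G : SimpleGraph V) (c : Sym2 V → α) : Prop :=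
  ∀ e₁ ∈ G.edgeSet, ∀ e₂ ∈ G.edgeSet, e₁ ≠ e₂ → (∃ v, v ∈ e₁ ∧ v ∈ e₂) → c e₁ ≠ c e₂

/-- An acyclic edge coloring: proper, and no cycle of `G` uses at most two colors. -/
def IsAcyclicEdgeColoring {V : Type*} {α : Type*} (G : SimpleGraph V) (c : Sym2 V → α) : Prop :=
  IsProperEdgeColoring G c ∧
    ∀ (v : V) (w : G.Walk v v), w.IsCycle →
      ¬ ∃ a b : α, ∀ e ∈ w.edges, c e = a ∨ c e = b

/-- `G` has an acyclic edge coloring with `k` colors. -/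
def AcyclicEdgeColorable {V : Type*} (G : SimpleGraph V) (k : ℕ) : Prop :=
  ∃ c : Sym2 V → Fin k, IsAcyclicEdgeColoring G c

/-- The acyclic chromatic index: least `k` such that `G` is acyclically edge `k`-colorable. -/
noncomputable def acyclicChromaticIndex {V : Type*} (G : SimpleGraph V) : ℕ :=
  sInf {k | AcyclicEdgeColorable G k}

/-- `G` is acyclically edge `k`-critical: `G` is not acyclically edge `k`-colorable, but every
proper subgraph of `G` is. -/
def IsAcyclicallyEdgeCritical {V : Type*} (G : SimpleGraph V) (k : ℕ) : Prop :=
  ¬ AcyclicEdgeColorable G k ∧ ∀ H : SimpleGraph V, H < G → AcyclicEdgeColorable H k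

section PartialColoring

variable {V K : Type*} {c c' : Sym2 V → Option K} {α β γ : K} {u w x y z : V}

/-- The graph formed by the edges colored `α` or `β` in the partial edge coloring `c`. -/
def bicolored (c : Sym2 V → Option K) (α β : K) : SimpleGraph V where
  Adj u w := u ≠ w ∧ (c s(u, w) = some α ∨ c s(u, w) = some β)
  symm := ⟨fun u w h => ⟨h.1.symm, by rw [Sym2.eq_swap]; exact h.2⟩⟩
  loopless := ⟨fun _ h => h.1 rfl⟩

/-- Two vertices are linked if a bichromatic path with the two given colors joins them. -/
def Linked (c : Sym2 V → Option K) (α β : K) (u w : V) : Prop :=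
  (bicolored c α β).Reachable u w

/-- An acyclic edge coloring of the graph of all edges which receive a color. -/
structure IsPartialAcyclic (c : Sym2 V → Option K) : Prop where
  loopless : ∀ u, c s(u, u) = none
  proper : ∀ u w w' α, c s(u, w) = some α → c s(u, w') = some α → w = w'
  acyclic : ∀ α β, (bicolored c α β).IsAcyclic

open Classical in
/-- The finite set of colors which appear at the vertex `u`. -/
noncomputable def palette [Fintype K] (c : Sym2 V → Option K) (u : V) : Finset K :=
  {α | ∃ w, c s(u, w) = some α}

theorem mem_palette [Fintype K] : α ∈ palette c u ↔ ∃ w, c s(u, w) = some α := by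
  simp [palette]

theorem bicolored_comm : bicolored c α β = bicolored c β α := by
  ext u w
  simp [bicolored, or_comm]

theorem Linked.swap (h : Linked c α β u w) : Linked c β α u w := by
  unfold Linked at *
  rwa [bicolored_comm]

theorem Linked.symm (h : Linked c α β u w) : Linked c α β w u :=
  SimpleGraph.Reachable.symm h

theorem Linked.mono (h : Linked c α β u w) (hα : ∀ e, c e = some α → c' e = some α)
    (hβ : ∀ e, c e = some β → c' e = some β) : Linked c' α β u w := by
  refine SimpleGraph.Reachable.mono (G := bicolored c α β) ?_ h
  exact fun _ _ h => ⟨h.1, h.2.imp (hα _) (hβ _)⟩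

theorem IsPartialAcyclic.ne_of_some (hc : IsPartialAcyclic c) (h : c s(u, w) = some α) :
    u ≠ w := by
  rintro rfl
  simp [hc.loopless] at h

theorem IsPartialAcyclic.of_le (hc : IsPartialAcyclic c)
    (h : ∀ e α, c' e = some α → c e = some α) : IsPartialAcyclic c' where
  loopless u := by
    by_contra hu
    obtain ⟨α, hα⟩ := Option.ne_none_iff_exists'.1 hu
    simpa [hc.loopless] using h _ _ hα
  proper u w w' α hw hw' := hc.proper u w w' α (h _ _ hw) (h _ _ hw')
  acyclic α β := by
    refine (hc.acyclic α β).anti ?_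
    exact fun _ _ h' => ⟨h'.1, h'.2.imp (h _ _) (h _ _)⟩

variable [Fintype K]

theorem mem_palette_left (h : c s(u, w) = some α) : α ∈ palette c u :=
  mem_palette.2 ⟨w, h⟩

theorem mem_palette_right (h : c s(u, w) = some α) : α ∈ palette c w :=
  mem_palette.2 ⟨u, by rwa [Sym2.eq_swap]⟩

theorem not_linked_of_notMem (huw : u ≠ w) (hα : α ∉ palette c u) (hβ : β ∉ palette c u) :
    ¬ Linked c α β u w := by
  rintro ⟨p⟩
  cases p with
  | nil => exact absurd rfl huw
  | cons h p => exact h.2.elim (fun h => hα (mem_palette_left h)) fun h => hβ (mem_palette_left h)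

theorem Linked.exists_first (hc : IsPartialAcyclic c) (h : Linked c α β u w) (huw : u ≠ w)
    (hu : α ∉ palette c u) (hw : β ∉ palette c w) :
    ∃ n, c s(u, n) = some β ∧ α ∈ palette c n := by
  obtain ⟨p, hp⟩ := SimpleGraph.Reachable.exists_isPath h
  cases p with
  | nil => exact absurd rfl huw
  | @cons _ n _ hn p =>
    have hβ : c s(u, n) = some β := hn.2.resolve_left fun h => hu (mem_palette_left h)
    refine ⟨n, hβ, ?_⟩
    cases p with
    | nil => exact absurd (mem_palette_right hβ) hw
    | @cons _ m _ hm p =>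
      refine mem_palette_left (hm.2.resolve_right fun h => ?_)
      have : u = m := hc.proper n u m β (by rwa [Sym2.eq_swap]) h
      simp [this] at hp

theorem path_end_unique {B : SimpleGraph V}
    (h2 : ∀ u a b d, B.Adj u a → B.Adj u b → B.Adj u d → a = b ∨ a = d ∨ b = d)
    {y z : V} (hy : ∀ a b, B.Adj y a → B.Adj y b → a = b)
    (hz : ∀ a b, B.Adj z a → B.Adj z b → a = b) {u : V} (p : B.Walk u y) :
    ∀ (o : V) (q : B.Walk u z), B.Adj u o → p.IsPath → q.IsPath →
      o ∉ p.support → o ∉ q.support → y = z := by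
  induction p with
  | nil =>
    rintro o q ho - - - hq
    cases q with
    | nil => rfl
    | cons h q =>
      have := hy _ _ ho h
      simp [this] at hq
  | cons h p ih =>
    rintro o q ho hp hq hop hoq
    cases q with
    | nil =>
      have := hz _ _ ho h
      simp [this] at hop
    | cons h' q =>
      rw [SimpleGraph.Walk.cons_isPath_iff] at hp hq
      simp only [SimpleGraph.Walk.support_cons, List.mem_cons, not_or] at hop hoq
      rcases h2 _ _ _ _ ho h h' with e | e | e
      · exact absurd p.start_mem_support (e ▸ hop.2)
      · exact absurd q.start_mem_support (e ▸ hoq.2)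
      · subst e
        exact ih hy _ q h.symm hp.1 hq.1 hp.2 hq.2

theorem bicolored_eq_of_notMem (hc : IsPartialAcyclic c) (hu : α ∉ palette c u ∨ β ∉ palette c u)
    (a b : V) (ha : (bicolored c α β).Adj u a) (hb : (bicolored c α β).Adj u b) : a = b := by
  rcases hu with hu | hu
  · exact hc.proper u a b β (ha.2.resolve_left fun h => hu (mem_palette_left h))
      (hb.2.resolve_left fun h => hu (mem_palette_left h))
  · exact hc.proper u a b α (ha.2.resolve_right fun h => hu (mem_palette_left h))
      (hb.2.resolve_right fun h => hu (mem_palette_left h))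

/-- A bichromatic path has at most two ends. -/
theorem Linked.end_unique (hc : IsPartialAcyclic c) (hxy : Linked c α β x y)
    (hxz : Linked c α β x z) (hx : α ∉ palette c x ∨ β ∉ palette c x)
    (hy : α ∉ palette c y ∨ β ∉ palette c y) (hz : α ∉ palette c z ∨ β ∉ palette c z)
    (hne : x ≠ y) (hne' : x ≠ z) : y = z := by
  obtain ⟨p, hp⟩ := SimpleGraph.Reachable.exists_isPath hxy
  obtain ⟨q, hq⟩ := SimpleGraph.Reachable.exists_isPath hxz
  cases p with
  | nil => exact absurd rfl hne
  | cons h p =>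
    cases q with
    | nil => exact absurd rfl hne'
    | cons h' q =>
      obtain rfl := bicolored_eq_of_notMem hc hx _ _ h h'
      rw [SimpleGraph.Walk.cons_isPath_iff] at hp hq
      refine path_end_unique ?_ (bicolored_eq_of_notMem hc hy) (bicolored_eq_of_notMem hc hz) p _
        q h.symm hp.1 hq.1 hp.2 hq.2
      rintro u a b d ⟨-, ha⟩ ⟨-, hb⟩ ⟨-, hd⟩
      have := hc.proper u
      grind

end PartialColoring
section Update

variable {V K : Type*} [DecidableEq V] {c c' : Sym2 V → Option K} {α β γ : K}
  {n u w x y z : V}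

theorem IsPartialAcyclic.erase (hc : IsPartialAcyclic c) (e : Sym2 V) :
    IsPartialAcyclic (Function.update c e none) := by
  refine hc.of_le fun e' α h => ?_
  grind

/-- If uncoloring the edge `uw` cuts the bichromatic path from `x` to `y`, then both parts
survive. -/
theorem Linked.erase_cases (h : Linked c α β x y) (u w : V) :
    Linked (Function.update c s(u, w) none) α β x y ∨
      (Linked (Function.update c s(u, w) none) α β x u ∧
        Linked (Function.update c s(u, w) none) α β w y) ∨
      (Linked (Function.update c s(u, w) none) α β x w ∧
        Linked (Function.update c s(u, w) none) α β u y) := by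
  obtain ⟨p⟩ := h
  have refl : ∀ a, Linked (Function.update c s(u, w) none) α β a a :=
    fun a => SimpleGraph.Reachable.refl _
  induction p with
  | nil => exact .inl (refl _)
  | @cons a b y hab p ih =>
    by_cases he : s(a, b) = s(u, w)
    · rcases Sym2.eq_iff.1 he with ⟨rfl, rfl⟩ | ⟨rfl, rfl⟩
      · rcases ih with h | h | h
        · exact .inr (.inl ⟨refl _, h⟩)
        · exact .inr (.inl ⟨refl _, h.2⟩)
        · exact .inl h.2
      · rcases ih with h | h | h
        · exact .inr (.inr ⟨refl _, h⟩)
        · exact .inl h.2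
        · exact .inr (.inr ⟨refl _, h.2⟩)
    · have hab' : (bicolored (Function.update c s(u, w) none) α β).Adj a b := by
        refine ⟨hab.1, ?_⟩
        rw [Function.update_of_ne he]
        exact hab.2
      exact ih.imp hab'.reachable.trans
        (Or.imp (And.imp_left hab'.reachable.trans) (And.imp_left hab'.reachable.trans))

theorem Linked.erase (h : Linked c α β y u) (w : V) :
    Linked (Function.update c s(u, w) none) α β y u ∨
      Linked (Function.update c s(u, w) none) α β y w := by
  rcases h.erase_cases u w with h | h | h
  exacts [.inl h, .inl h.1, .inr h.1]

theorem Linked.of_insert (h : Linked (Function.update c s(u, w) (some γ)) α β x y)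
    (hα : α ≠ γ) (hβ : β ≠ γ) : Linked c α β x y := by
  refine h.mono (fun e he => ?_) fun e he => ?_ <;> grind

theorem Linked.insert (h : Linked c α β x y) (hn : c s(u, w) = none) :
    Linked (Function.update c s(u, w) (some γ)) α β x y := by
  refine h.mono (fun e he => ?_) fun e he => ?_ <;> grind

theorem Linked.of_erase (h : Linked (Function.update c s(u, w) none) α β x y) :
    Linked c α β x y := by
  refine h.mono (fun e he => ?_) fun e he => ?_ <;> grind

theorem Linked.erase_of_ne (h : Linked c α β x y) (hn : c s(u, w) = some γ)
    (hα : α ≠ γ) (hβ : β ≠ γ) :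
    Linked (Function.update c s(u, w) none) α β x y := by
  refine h.mono (fun e he => ?_) fun e he => ?_ <;> grind

variable [Fintype K]

theorem mem_palette_erase (hc : IsPartialAcyclic c) (h : c s(u, w) = some γ) :
    α ∈ palette (Function.update c s(u, w) none) n ↔
      α ∈ palette c n ∧ ¬ (α = γ ∧ (n = u ∨ n = w)) := by
  have h1 := hc.proper u
  have h2 := hc.proper w
  have h3 : c s(w, u) = some γ := by rwa [Sym2.eq_swap]
  simp only [mem_palette, Function.update_apply, Sym2.eq_iff]
  constructor
  · rintro ⟨m, hm⟩
    grind
  · rintro ⟨⟨m, hm⟩, hne⟩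
    refine ⟨m, ?_⟩
    grind

theorem mem_palette_insert (h : c s(u, w) = none) :
    α ∈ palette (Function.update c s(u, w) (some γ)) n ↔
      α ∈ palette c n ∨ (α = γ ∧ (n = u ∨ n = w)) := by
  have h3 : c s(w, u) = none := by rwa [Sym2.eq_swap]
  simp only [mem_palette, Function.update_apply, Sym2.eq_iff]
  constructor
  · rintro ⟨m, hm⟩
    grind
  · rintro (⟨m, hm⟩ | ⟨rfl, rfl | rfl⟩)
    · refine ⟨m, ?_⟩
      grind
    · exact ⟨w, by simp⟩
    · exact ⟨u, by simp⟩

/-- Uncoloring the last edge of a bichromatic path does not affect links between other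
vertices. -/
theorem Linked.erase_pendant (hc : IsPartialAcyclic c) (h : Linked c α β x y)
    (hn : c s(z, n) = some β) (hz : α ∉ palette c z) (hzx : z ≠ x) (hzy : z ≠ y) :
    Linked (Function.update c s(z, n) none) α β x y := by
  have h1 : α ∉ palette (Function.update c s(z, n) none) z := by
    simp [mem_palette_erase hc hn, hz]
  have h2 : β ∉ palette (Function.update c s(z, n) none) z := by
    simp [mem_palette_erase hc hn]
  rcases h.erase_cases z n with h | h | h
  · exact h
  · exact absurd h.1.symm (not_linked_of_notMem hzx h1 h2)
  · exact absurd h.2 (not_linked_of_notMem hzy h1 h2)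

/-- An uncolored edge can be given a color which creates no bichromatic cycle. -/
theorem IsPartialAcyclic.insert (hc : IsPartialAcyclic c) (huw : u ≠ w)
    (hu : γ ∉ palette c u) (hw : γ ∉ palette c w)
    (hl : ∀ β ∈ palette c u, β ∈ palette c w → ¬ Linked c γ β u w) :
    IsPartialAcyclic (Function.update c s(u, w) (some γ)) := by
  have hl' : ∀ β, ¬ Linked c γ β u w := by
    intro β
    by_cases h1 : β ∈ palette c u
    · by_cases h2 : β ∈ palette c w
      · exact hl β h1 h2
      · exact fun h => not_linked_of_notMem huw.symm hw h2 h.symm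
    · exact not_linked_of_notMem huw hu h1
  have hb : ∀ β, (bicolored (Function.update c s(u, w) (some γ)) γ β).IsAcyclic := by
    intro β
    refine ((hc.acyclic γ β).sup_edge_of_not_reachable (hl' β)).anti ?_
    rintro a b ⟨hab, h'⟩
    rw [SimpleGraph.sup_adj, SimpleGraph.adj_edge]
    by_cases he : s(a, b) = s(u, w)
    · exact .inr ⟨he.symm, hab⟩
    · rw [Function.update_of_ne he] at h'
      exact .inl ⟨hab, h'⟩
  refine ⟨fun a => ?_, fun a b d α hab had => ?_, fun α β => ?_⟩
  · rw [Function.update_of_ne, hc.loopless]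
    simp only [ne_eq, Sym2.eq_iff]
    grind
  · have h1 := hc.proper a b d α
    have h2 : ∀ m, c s(u, m) ≠ some γ := fun m hm => hu (mem_palette_left hm)
    have h3 : ∀ m, c s(w, m) ≠ some γ := fun m hm => hw (mem_palette_left hm)
    simp only [Function.update_apply, Sym2.eq_iff] at hab had
    grind
  · by_cases hα : α = γ
    · exact hα ▸ hb β
    by_cases hβ : β = γ
    · subst hβ
      rw [bicolored_comm]
      exact hb α
    refine (hc.acyclic α β).anti ?_
    rintro a b ⟨hab, h'⟩
    refine ⟨hab, ?_⟩
    by_cases he : s(a, b) = s(u, w)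
    · rw [he, Function.update_self] at h'
      grind
    · rwa [Function.update_of_ne he] at h'

end Update
section Swap

variable {V K : Type*} [DecidableEq V] [Fintype K] {c : Sym2 V → Option K} {σ τ : K}
  {x p q : V}

/-- Interchanging the colors of two edges `xp` and `xq`, when neither `p` nor `q` sees
another color of `x`. A path in the colors `r` and `σ` which used to end at `x` then ends
at `p`. -/
theorem IsPartialAcyclic.exists_swap (hc : IsPartialAcyclic c) (hp : c s(x, p) = some σ)
    (hq : c s(x, q) = some τ) (hne : σ ≠ τ)
    (hdp : ∀ β ∈ palette c x, β ≠ σ → β ∉ palette c p)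
    (hdq : ∀ β ∈ palette c x, β ≠ τ → β ∉ palette c q) :
    ∃ c' : Sym2 V → Option K, IsPartialAcyclic c' ∧ (∀ e, c' e = none ↔ c e = none) ∧
      (∀ e β, β ≠ σ → β ≠ τ → (c' e = some β ↔ c e = some β)) ∧
      (∀ n, n ≠ p → n ≠ q → palette c' n = palette c n) ∧ σ ∉ palette c' p ∧
      ∀ r w, r ≠ σ → r ≠ τ → r ∉ palette c x → w ≠ x →
        Linked c r σ w x → Linked c' r σ w p := by
  have hpq : p ≠ q := by
    rintro rfl
    rw [hp] at hq
    exact hne (Option.some_injective _ hq)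
  have hxp := hc.ne_of_some hp
  have hxq := hc.ne_of_some hq
  have hepq : s(x, q) ≠ s(x, p) := by simp; grind
  set c₁ := Function.update c s(x, p) none with hc₁
  have h₁ : IsPartialAcyclic c₁ := hc.erase _
  have hq₁ : c₁ s(x, q) = some τ := by rw [hc₁, Function.update_of_ne hepq, hq]
  have mem₁ : ∀ n α, α ∈ palette c₁ n ↔ α ∈ palette c n ∧ ¬ (α = σ ∧ (n = x ∨ n = p)) :=
    fun n α => mem_palette_erase hc hp
  set c₂ := Function.update c₁ s(x, q) none with hc₂
  have h₂ : IsPartialAcyclic c₂ := h₁.erase _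
  have mem₂ : ∀ n α, α ∈ palette c₂ n ↔ α ∈ palette c₁ n ∧ ¬ (α = τ ∧ (n = x ∨ n = q)) :=
    fun n α => mem_palette_erase h₁ hq₁
  set c₃ := Function.update c₂ s(x, p) (some τ) with hc₃
  have hp₂ : c₂ s(x, p) = none := by
    rw [hc₂, Function.update_of_ne hepq.symm, hc₁, Function.update_self]
  have hσ := mem_palette_left hp
  have hτ := mem_palette_left hq
  have h₃ : IsPartialAcyclic c₃ := by
    refine h₂.insert hxp ?_ ?_ ?_ <;> grind
  have mem₃ : ∀ n α, α ∈ palette c₃ n ↔ α ∈ palette c₂ n ∨ (α = τ ∧ (n = x ∨ n = p)) :=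
    fun n α => mem_palette_insert hp₂
  have hq₃ : c₃ s(x, q) = none := by
    rw [hc₃, Function.update_of_ne hepq, hc₂, Function.update_self]
  set c₄ := Function.update c₃ s(x, q) (some σ) with hc₄
  have h₄ : IsPartialAcyclic c₄ := by
    refine h₃.insert hxq ?_ ?_ ?_ <;> grind
  have mem₄ : ∀ n α, α ∈ palette c₄ n ↔ α ∈ palette c₃ n ∨ (α = σ ∧ (n = x ∨ n = q)) :=
    fun n α => mem_palette_insert hq₃
  refine ⟨c₄, h₄, ?_, ?_, ?_, ?_, ?_⟩
  · intro e; grind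
  · intro e β h1 h2; grind
  · intro n hnp hnq
    ext α
    grind
  · grind
  · intro r w hrσ hrτ hr hwx hl
    have hl₁ : Linked c₁ r σ w p := by
      refine (hl.erase p).resolve_left fun h => ?_
      exact not_linked_of_notMem hwx.symm (by grind) (by grind) h.symm
    exact ((hl₁.erase_of_ne hq₁ hrτ hne).insert hp₂).insert hq₃

end Swap
theorem Finset.exists_notMem_of_card_lt {K : Type*} [Fintype K] (A B : Finset K)
    (h : A.card + B.card < Fintype.card K) :
    ∃ t, t ∉ A ∧ t ∉ B := by
  classical
  by_contra! h'
  have h1 : Finset.univ ⊆ A ∪ B := fun t _ => by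
    have := h' t
    simp
    tauto
  have h2 := (Finset.card_le_card h1).trans (Finset.card_union_le A B)
  rw [Finset.card_univ] at h2
  omega

section Obstruction

variable {V K : Type*} [Fintype K] {D : Set (Sym2 V)} {x y z : V} {d : V → ℕ}
  {c : Sym2 V → Option K} {α β γ a b r s t : K}

/-- An acyclic coloring of the edge set `D`. -/
def IsColoringOf (D : Set (Sym2 V)) (c : Sym2 V → Option K) : Prop :=
  IsPartialAcyclic c ∧ ∀ e, c e = none ↔ e ∉ D

/-- The edge set `D`, in which `n` has degree `d n`, can be colored acyclically, but no coloring
extends to a new vertex of degree three with neighbors `x`, `y`, `z`, where `x` has degree three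
in `D`. The number of colors exceeds every degree by at least two, and the degrees of `y` and
`z` by at least three. -/
structure IsObstruction (K : Type*) [Fintype K] (D : Set (Sym2 V)) (x y z : V) (d : V → ℕ) :
    Prop where
  hxy : x ≠ y
  hxz : x ≠ z
  hyz : y ≠ z
  unextendable : ∀ c : Sym2 V → Option K, IsColoringOf D c → ∀ r s t : K, r ≠ s → r ≠ t → s ≠ t →
    r ∉ palette c x → s ∉ palette c y → t ∉ palette c z →
    Linked c r s x y ∨ Linked c s t y z ∨ Linked c r t x z
  card_palette : ∀ c : Sym2 V → Option K, IsColoringOf D c → ∀ n, (palette c n).card = d n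
  degree_x : d x = 3
  degree_y : d y + 3 ≤ Fintype.card K
  degree_z : d z + 3 ≤ Fintype.card K
  degree_le : ∀ n, d n + 2 ≤ Fintype.card K
  six_le : 6 ≤ Fintype.card K

namespace IsObstruction

variable (F : IsObstruction K D x y z d) (hc : IsColoringOf D c)

include F in
theorem symm : IsObstruction K D x z y d where
  hxy := F.hxz
  hxz := F.hxy
  hyz := F.hyz.symm
  unextendable c hc r s t hrs hrt hst hr hs ht := by
    rcases F.unextendable c hc r t s hrt hrs hst.symm hr ht hs with h | h | h
    · exact .inr (.inr h)
    · exact .inr (.inl h.swap.symm)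
    · exact .inl h
  card_palette := F.card_palette
  degree_x := F.degree_x
  degree_y := F.degree_z
  degree_z := F.degree_y
  degree_le := F.degree_le
  six_le := F.six_le

include F hc

theorem linked_of_notMem (hs : s ∉ palette c y) (ht : t ∉ palette c z) (hst : s ≠ t)
    (hsx : s ∉ palette c x) (htx : t ∉ palette c x) : Linked c s t y z := by
  classical
  obtain ⟨r, hr⟩ : ∃ r, r ∉ insert s (insert t (palette c x)) := by
    by_contra! h
    have h1 := Finset.card_le_card (fun α _ => h α : Finset.univ ⊆ _)
    have h2 := Finset.card_insert_le s (insert t (palette c x))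
    have h3 := Finset.card_insert_le t (palette c x)
    have := F.six_le
    have := F.card_palette c hc x
    have := F.degree_x
    rw [Finset.card_univ] at h1
    omega
  simp only [Finset.mem_insert, not_or] at hr
  rcases F.unextendable c hc r s t hr.1 hr.2.1 hst hr.2.2 hs ht with h | h | h
  · exact absurd h (not_linked_of_notMem F.hxy hr.2.2 hsx)
  · exact h
  · exact absurd h (not_linked_of_notMem F.hxz hr.2.2 htx)

theorem linked_of_notMem_right (hs : s ∉ palette c y) (hsx : s ∈ palette c x)
    (ht : t ∉ palette c z) (htx : t ∉ palette c x) (hl : ¬ Linked c s t y z)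
    (hr : r ∉ palette c x) (hrt : r ≠ t) : Linked c r s x y := by
  rcases F.unextendable c hc r s t (by grind) hrt (by grind) hr hs ht with h | h | h
  · exact h
  · exact absurd h hl
  · exact absurd h (not_linked_of_notMem F.hxz hr htx)

theorem linked_of_mem (hs : s ∉ palette c y) (hsx : s ∈ palette c x)
    (ht : t ∉ palette c z) (htx : t ∈ palette c x) (hst : s ≠ t) (hl : ¬ Linked c s t y z)
    (hr : r ∉ palette c x) : Linked c r s x y ∨ Linked c r t x z := by
  rcases F.unextendable c hc r s t (by grind) (by grind) hst hr hs ht with h | h | h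
  · exact .inl h
  · exact absurd h hl
  · exact .inr h

theorem not_linked_x_z (h : Linked c r s x y) (hr : r ∉ palette c x) (hy : s ∉ palette c y)
    (hz : r ∉ palette c z ∨ s ∉ palette c z) : ¬ Linked c r s x z := fun h' =>
  F.hyz (h.end_unique hc.1 h' (.inl hr) (.inr hy) hz F.hxy F.hxz)

theorem not_linked_y_z (h : Linked c r s x y) (hr : r ∉ palette c x) (hy : s ∉ palette c y)
    (hz : r ∉ palette c z ∨ s ∉ palette c z) : ¬ Linked c r s y z := fun h' =>
  F.hxz (h.symm.end_unique hc.1 h' (.inr hy) (.inl hr) hz F.hxy.symm F.hyz)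

theorem mem_palette_y_iff (ha : a ∈ palette c x) (hay : a ∉ palette c y) (hb : b ∉ palette c x)
    (hbz : b ∉ palette c z) (hab : ¬ Linked c a b y z) :
    ∀ γ, γ ∈ palette c y ↔ γ ∉ palette c x := by
  classical
  have hS : (palette c x)ᶜ.erase b ⊆ palette c y := by
    intro r hr
    simp only [Finset.mem_erase, Finset.mem_compl] at hr
    have h := F.linked_of_notMem_right hc hay ha hbz hb hab hr.2 hr.1
    obtain ⟨n, hn, -⟩ := h.symm.swap.exists_first hc.1 F.hxy.symm hay hr.2
    exact mem_palette_left hn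
  have hX := F.card_palette c hc x
  have hY := F.card_palette c hc y
  have hZ := F.card_palette c hc z
  have hx := F.degree_x
  have hy := F.degree_y
  have hz := F.degree_z
  have h6 := F.six_le
  have hSc : ((palette c x)ᶜ.erase b).card = Fintype.card K - 4 := by
    rw [Finset.card_erase_of_mem (by simpa using hb), Finset.card_compl]
    omega
  have hby : b ∈ palette c y := by
    by_contra hby
    have hcov : ∀ q ∈ palette c x, q ∉ palette c y → q ∈ palette c z := by
      intro q hq hqy
      by_contra hqz
      obtain ⟨r, hr⟩ : ((palette c x)ᶜ.erase b).Nonempty := Finset.card_pos.1 (by omega)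
      simp only [Finset.mem_erase, Finset.mem_compl] at hr
      have h1 := F.linked_of_notMem_right hc hqy hq hbz hb
        (not_linked_of_notMem F.hyz hqy hby) hr.2 hr.1
      have h2 := F.symm.linked_of_notMem_right hc hqz hq hby hb
        (not_linked_of_notMem F.hyz.symm hqz hbz) hr.2 hr.1
      exact F.not_linked_x_z hc h1 hr.2 hqy (.inr hqz) h2
    have hsub : (palette c z)ᶜ.erase b ⊆ palette c y ∩ palette c x := by
      intro b' hb'
      simp only [Finset.mem_erase, Finset.mem_compl] at hb'
      have hb'x : b' ∈ palette c x := by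
        by_contra hb'x
        exact not_linked_of_notMem F.hyz.symm hb'.2 hbz
          (F.linked_of_notMem hc hby hb'.2 hb'.1.symm hb hb'x).symm.swap
      have := hcov b' hb'x
      grind
    have hdisj : Disjoint ((palette c z)ᶜ.erase b) ((palette c x)ᶜ.erase b) := by
      rw [Finset.disjoint_left]
      intro γ h1 h2
      have := hsub h1
      simp_all
    have hle := Finset.card_le_card
      (Finset.union_subset (hsub.trans Finset.inter_subset_left) hS)
    rw [Finset.card_union_of_disjoint hdisj, Finset.card_erase_of_mem (by simpa using hbz),
      Finset.card_compl] at hle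
    omega
  have hsub : (palette c x)ᶜ ⊆ palette c y := by
    intro r hr
    by_cases hrb : r = b
    · exact hrb ▸ hby
    · exact hS (by simp [hrb] at hr ⊢; exact hr)
  have heq := Finset.eq_of_subset_of_card_le hsub (by rw [Finset.card_compl]; omega)
  intro γ
  rw [← heq, Finset.mem_compl]

theorem mem_palette_iff_of_forall {n : V} (hsx : s ∈ palette c x) (hs : s ∈ palette c n)
    (h : ∀ r ∉ palette c x, r ∈ palette c n) :
    ∀ γ, γ ∈ palette c n ↔ γ ∉ palette c x ∨ γ = s := by
  classical
  have hsub : insert s (palette c x)ᶜ ⊆ palette c n := by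
    intro r hr
    rcases Finset.mem_insert.1 hr with rfl | hr
    · exact hs
    · exact h r (Finset.mem_compl.1 hr)
  have hX := F.card_palette c hc x
  have hN := F.card_palette c hc n
  have hx := F.degree_x
  have hle := F.degree_le n
  have h6 := F.six_le
  have heq := Finset.eq_of_subset_of_card_le hsub (by
    rw [Finset.card_insert_of_notMem (by simpa using hsx), Finset.card_compl]
    omega)
  intro γ
  rw [← heq]
  simp [or_comm]

theorem mem_palette_neighbor_iff {n : V} (hn : c s(x, n) = some s)
    (h : ∀ r ∉ palette c x, ∃ w, w ≠ x ∧ s ∉ palette c w ∧ Linked c r s x w) :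
    ∀ γ, γ ∈ palette c n ↔ γ ∉ palette c x ∨ γ = s := by
  refine F.mem_palette_iff_of_forall hc (mem_palette_left hn) (mem_palette_right hn)
    fun r hr => ?_
  obtain ⟨w, hwx, hw, hl⟩ := h r hr
  obtain ⟨m, hm, hmr⟩ := hl.exists_first hc.1 hwx.symm hr hw
  rwa [hc.1.proper x n m s hn hm]

theorem ne_of_mem_palette_iff {n w : V} (hs : s ∈ palette c x)
    (hn : ∀ γ, γ ∈ palette c n ↔ γ ∉ palette c x ∨ γ = s)
    (hw : d w + 3 ≤ Fintype.card K) : w ≠ n := by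
  classical
  rintro rfl
  have heq : palette c w = insert s (palette c x)ᶜ := by
    ext γ
    simp [hn, or_comm]
  have hX := F.card_palette c hc x
  have hW := F.card_palette c hc w
  have hx := F.degree_x
  rw [heq, Finset.card_insert_of_notMem (by simpa using hs), Finset.card_compl] at hW
  omega

theorem false_of_swap [DecidableEq V] {n m : V} (hab : a ≠ b)
    (hn : c s(x, n) = some a) (hm : c s(x, m) = some b)
    (hna : ∀ γ, γ ∈ palette c n ↔ γ ∉ palette c x ∨ γ = a)
    (hmb : ∀ γ, γ ∈ palette c m ↔ γ ∉ palette c x ∨ γ = b)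
    (hay : a ∉ palette c y) (ht : t ∉ palette c z) (hr : r ∉ palette c x) (hrt : r ≠ t)
    (hta : t ≠ a) (htb : t ≠ b) (hra : Linked c r a x y)
    (h : (t ∉ palette c x ∧ Linked c t a x y) ∨ (t ∉ palette c y ∧ Linked c r t x y)) :
    False := by
  have hax := mem_palette_left hn
  have hbx := mem_palette_left hm
  obtain ⟨c', hc', hdom, hcol, hpal, han, hlink⟩ := hc.1.exists_swap hn hm hab
    (by grind) (by grind)
  have hyn := F.ne_of_mem_palette_iff hc hax hna F.degree_y
  have hym := F.ne_of_mem_palette_iff hc hbx hmb F.degree_y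
  have hzn := F.ne_of_mem_palette_iff hc hax hna F.degree_z
  have hzm := F.ne_of_mem_palette_iff hc hbx hmb F.degree_z
  have hx := hpal x (hc.1.ne_of_some hn) (hc.1.ne_of_some hm)
  have hy := hpal y hyn hym
  have hz := hpal z hzn hzm
  have hcD : IsColoringOf D c' := ⟨hc', fun e => (hdom e).trans (hc.2 e)⟩
  have hyn' := hlink r y (by grind) (by grind) hr F.hxy.symm hra.symm
  rcases F.unextendable c' hcD r a t (by grind) hrt hta.symm (hx ▸ hr) (hy ▸ hay) (hz ▸ ht)
    with h1 | h1 | h1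
  · exact hc.1.ne_of_some hn (h1.symm.end_unique hc' hyn' (.inr (hy ▸ hay)) (.inl (hx ▸ hr))
      (.inr han) F.hxy.symm hyn)
  · rcases h with ⟨htx, hta'⟩ | ⟨hty, -⟩
    · have := hlink t y hta htb htx F.hxy.symm hta'.symm
      exact hzn (h1.swap.end_unique hc' this (.inr (hy ▸ hay)) (.inl (hz ▸ ht)) (.inr han)
        F.hyz hyn)
    · exact not_linked_of_notMem F.hyz (hy ▸ hay) (hy ▸ hty) h1
  · rcases h with ⟨htx, -⟩ | ⟨hty, hrt'⟩
    · exact not_linked_of_notMem F.hxz (hx ▸ hr) (hx ▸ htx) h1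
    · have h2 : Linked c' r t x y :=
        hrt'.mono (fun e he => (hcol e r (by grind) (by grind)).2 he)
          fun e he => (hcol e t hta htb).2 he
      exact F.not_linked_x_z hcD h2 (hx ▸ hr) (hy ▸ hty) (.inr (hz ▸ ht)) h1

theorem exists_notMem_z (s t : K) : ∃ γ ∉ palette c z, γ ≠ s ∧ γ ≠ t := by
  classical
  have h1 := F.card_palette c hc z
  have h2 := F.degree_z
  have h3 := Finset.card_le_two (a := s) (b := t)
  obtain ⟨γ, h, h'⟩ := Finset.exists_notMem_of_card_lt (palette c z) {s, t} (by omega)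
  exact ⟨γ, h, by simpa using h'⟩

theorem exists_other_pair (hs : s ∈ palette c x) :
    ∃ p ∈ palette c x, ∃ q ∈ palette c x, p ≠ q ∧ p ≠ s ∧ q ≠ s ∧
      ∀ t ∈ palette c x, t = s ∨ t = p ∨ t = q := by
  classical
  have h1 : ((palette c x).erase s).card = 2 := by
    rw [Finset.card_erase_of_mem hs, F.card_palette c hc, F.degree_x]
  obtain ⟨p, q, hpq, h⟩ := Finset.card_eq_two.1 h1
  have hmem : ∀ t, t ∈ (palette c x).erase s ↔ t = p ∨ t = q := by simp [h]
  simp only [Finset.mem_erase] at hmem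
  have hp := (hmem p).2 (.inl rfl)
  have hq := (hmem q).2 (.inr rfl)
  refine ⟨p, hp.2, q, hq.2, hpq, hp.1, hq.1, fun t ht => ?_⟩
  have := hmem t
  tauto

theorem mem_palette_z [DecidableEq V] (ha : a ∈ palette c x) (hay : a ∉ palette c y)
    (hb : b ∉ palette c x) (hbz : b ∉ palette c z) (hab : ¬ Linked c a b y z) :
    ∀ p ∈ palette c x, p ∈ palette c z := by
  intro p hp
  by_contra hpz
  have hY := F.mem_palette_y_iff hc ha hay hb hbz hab
  have hxy : ∀ s ∈ palette c x, s ∉ palette c y := fun s hs => by simpa [hY] using hs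
  have hp' : ∀ r ∉ palette c x, r ≠ b → Linked c r p x y := fun r hr hrb =>
    F.linked_of_notMem_right hc (hxy p hp) hp hbz hb
      (fun h => not_linked_of_notMem F.hyz.symm hpz hbz h.symm) hr hrb
  have hpb : Linked c b p x y := by
    obtain ⟨t, htz, htb, htp⟩ := F.exists_notMem_z hc b p
    have hpt : ¬ Linked c p t y z := fun h => not_linked_of_notMem F.hyz.symm hpz htz h.symm
    by_cases ht : t ∈ palette c x
    · exact (F.linked_of_mem hc (hxy p hp) hp htz ht htp.symm hpt hb).resolve_right
        fun h => not_linked_of_notMem F.hxz.symm hbz htz h.symm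
    · exact F.linked_of_notMem_right hc (hxy p hp) hp htz ht hpt hb htb.symm
  have hgood : ∀ s ∈ palette c x, s ≠ p → ∀ r ∉ palette c x, Linked c r s x y := by
    intro s hs hsp r hr
    refine (F.linked_of_mem hc (hxy s hs) hs hpz hp hsp
      (not_linked_of_notMem F.hyz (hxy s hs) (hxy p hp)) hr).resolve_right ?_
    by_cases hrb : r = b
    · exact fun h => not_linked_of_notMem F.hxz.symm (hrb ▸ hbz) hpz h.symm
    · exact F.not_linked_x_z hc (hp' r hr hrb) hr (hxy p hp) (.inr hpz)
  obtain ⟨s, hs, t, ht, hst, hsp, htp, -⟩ := F.exists_other_pair hc hp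
  obtain ⟨n, hn⟩ := mem_palette.1 hs
  obtain ⟨m, hm⟩ := mem_palette.1 ht
  exact F.false_of_swap hc hst hn hm
    (F.mem_palette_neighbor_iff hc hn
      fun r hr => ⟨y, F.hxy.symm, hxy s hs, hgood s hs hsp r hr⟩)
    (F.mem_palette_neighbor_iff hc hm
      fun r hr => ⟨y, F.hxy.symm, hxy t ht, hgood t ht htp r hr⟩)
    (hxy s hs) hpz hb (by grind) hsp.symm htp.symm (hgood s hs hsp b hb)
    (.inr ⟨hxy p hp, hpb⟩)

theorem linked_x_y (hs : s ∈ palette c x) (hsy : s ∉ palette c y)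
    (hsub : ∀ p ∈ palette c x, p ∈ palette c z) (ht : t ∉ palette c z)
    (hst : ¬ Linked c s t y z) : ∀ r ∉ palette c x, Linked c r s x y := by
  intro r hr
  have htx : t ∉ palette c x := fun h => ht (hsub t h)
  by_cases hrt : r = t
  · obtain ⟨t', ht', htt', -⟩ := F.exists_notMem_z hc t t
    have htx' : t' ∉ palette c x := fun h => ht' (hsub t' h)
    have h := F.linked_of_notMem_right hc hsy hs ht htx hst htx' htt'
    refine F.linked_of_notMem_right hc hsy hs ht' htx' (fun h' => ?_) hr (hrt ▸ htt'.symm)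
    exact F.not_linked_y_z hc h htx' hsy (.inl ht') h'.swap
  · exact F.linked_of_notMem_right hc hsy hs ht htx hst hr hrt

theorem linked_y_z [DecidableEq V] (ha : a ∈ palette c x) (hay : a ∉ palette c y)
    (hb : b ∉ palette c x) (hbz : b ∉ palette c z) (hab : ¬ Linked c a b y z) :
    ∀ s ∈ palette c x, s ≠ a → ∀ t ∉ palette c z, Linked c s t y z := by
  intro s hs hsa t ht
  by_contra hst
  have hY := F.mem_palette_y_iff hc ha hay hb hbz hab
  have hsub := F.mem_palette_z hc ha hay hb hbz hab
  have hsy : s ∉ palette c y := by simpa [hY] using hs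
  have h1 := F.linked_x_y hc ha hay hsub hbz hab
  have h2 := F.linked_x_y hc hs hsy hsub ht hst
  obtain ⟨n, hn⟩ := mem_palette.1 ha
  obtain ⟨m, hm⟩ := mem_palette.1 hs
  obtain ⟨r, hr, hrt, -⟩ := F.exists_notMem_z hc t t
  have htx : t ∉ palette c x := fun h => ht (hsub t h)
  have hrx : r ∉ palette c x := fun h => hr (hsub r h)
  exact F.false_of_swap hc hsa.symm hn hm
    (F.mem_palette_neighbor_iff hc hn fun r hr => ⟨y, F.hxy.symm, hay, h1 r hr⟩)
    (F.mem_palette_neighbor_iff hc hm fun r hr => ⟨y, F.hxy.symm, hsy, h2 r hr⟩)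
    hay ht hrx hrt (by grind) (by grind) (h1 r hrx) (.inl ⟨htx, h1 t htx⟩)

omit F hc in
/-- At least `m` edges at `u` lead to a vertex which is `x` or has degree at least four. -/
def _root_.LargeNeighbors (c : Sym2 V → Option K) (x : V) (d : V → ℕ) (u : V) (m : ℕ) : Prop :=
  ∃ A : Finset K, m ≤ A.card ∧ ∀ γ ∈ A, ∃ n, c s(u, n) = some γ ∧ (n = x ∨ 4 ≤ d n)

theorem four_le {n : V} (A : Finset K) (hA : 3 ≤ A.card) (hs : s ∉ A) (hn : s ∈ palette c n)
    (h : ∀ γ ∈ A, γ ∈ palette c n) : 4 ≤ d n := by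
  classical
  have h1 : insert s A ⊆ palette c n := by
    intro γ hγ
    rcases Finset.mem_insert.1 hγ with rfl | hγ
    exacts [hn, h γ hγ]
  have h2 := Finset.card_le_card h1
  rw [Finset.card_insert_of_notMem hs, F.card_palette c hc] at h2
  omega

theorem exists_compl : ∃ A : Finset K, 3 ≤ A.card ∧ ∀ t, t ∈ A ↔ t ∉ palette c z := by
  classical
  have h1 := F.card_palette c hc z
  have h2 := F.degree_z
  exact ⟨(palette c z)ᶜ, by rw [Finset.card_compl]; omega, by simp⟩

theorem largeNeighbors_y [DecidableEq V] (ha : a ∈ palette c x) (hay : a ∉ palette c y)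
    (hb : b ∉ palette c x) (hbz : b ∉ palette c z) (hab : ¬ Linked c a b y z) :
    LargeNeighbors c x d y 3 := by
  classical
  have hY := F.mem_palette_y_iff hc ha hay hb hbz hab
  have hsub := F.mem_palette_z hc ha hay hb hbz hab
  obtain ⟨A, hA, hmem⟩ := F.exists_compl hc
  refine ⟨A, hA, fun t ht => ?_⟩
  rw [hmem] at ht
  have htx : t ∉ palette c x := fun h => ht (hsub t h)
  obtain ⟨n, hn⟩ := mem_palette.1 ((hY t).2 htx)
  refine ⟨n, hn, .inr (F.four_le hc (palette c x) ?_ htx (mem_palette_right hn) fun s hs => ?_)⟩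
  · rw [F.card_palette c hc, F.degree_x]
  have hfirst : ∃ n, c s(y, n) = some t ∧ s ∈ palette c n := by
    by_cases hsa : s = a
    · subst hsa
      exact (F.linked_x_y hc ha hay hsub hbz hab t htx).symm.swap.exists_first hc.1 F.hxy.symm
        hay htx
    · exact (F.linked_y_z hc ha hay hb hbz hab s hs hsa t ht).exists_first hc.1 F.hyz
        (by simpa [hY] using hs) ht
  obtain ⟨m, hm, hsm⟩ := hfirst
  rwa [hc.1.proper y n m t hn hm]

theorem mem_palette_of_linked_y_z {n : V} (hn : c s(z, n) = some s) (hs : s ∉ palette c y)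
    (ht : t ∉ palette c z) (h : Linked c s t y z) : t ∈ palette c n := by
  obtain ⟨m, hm, htm⟩ := h.symm.swap.exists_first hc.1 F.hyz.symm ht hs
  rwa [hc.1.proper z n m s hn hm]

theorem four_le_degree_neighbor_z [DecidableEq V] (ha : a ∈ palette c x) (hay : a ∉ palette c y)
    (hb : b ∉ palette c x) (hbz : b ∉ palette c z) (hab : ¬ Linked c a b y z) :
    ∀ s ∈ palette c x, s ≠ a → ∃ n, c s(z, n) = some s ∧ 4 ≤ d n := by
  classical
  intro s hs hsa
  have hY := F.mem_palette_y_iff hc ha hay hb hbz hab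
  have hsz := F.mem_palette_z hc ha hay hb hbz hab s hs
  obtain ⟨n, hn⟩ := mem_palette.1 hsz
  obtain ⟨A, hA, hmem⟩ := F.exists_compl hc
  refine ⟨n, hn, F.four_le hc A hA (by simpa [hmem] using hsz) (mem_palette_right hn)
    fun t ht => ?_⟩
  rw [hmem] at ht
  exact F.mem_palette_of_linked_y_z hc hn (by simpa [hY] using hs) ht
    (F.linked_y_z hc ha hay hb hbz hab s hs hsa t ht)

theorem largeNeighbors_z [DecidableEq V] (ha : a ∈ palette c x) (hay : a ∉ palette c y)
    (hb : b ∉ palette c x) (hbz : b ∉ palette c z) (hab : ¬ Linked c a b y z) :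
    LargeNeighbors c x d z 2 := by
  classical
  refine ⟨(palette c x).erase a, ?_, fun s hs => ?_⟩
  · rw [Finset.card_erase_of_mem ha, F.card_palette c hc, F.degree_x]
  · rw [Finset.mem_erase] at hs
    obtain ⟨n, hn, h⟩ := F.four_le_degree_neighbor_z hc ha hay hb hbz hab s hs.2 hs.1
    exact ⟨n, hn, .inr h⟩

/-- The colors `r`, `s` and `a` for the edges to `x`, `y` and `z` extend the coloring. -/
theorem false_of_linked (hr : r ∉ palette c x) (hrz : r ∉ palette c z) (hs : s ∈ palette c x)
    (hsy : s ∉ palette c y) (ha : a ∈ palette c x) (hay : a ∉ palette c y)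
    (haz : a ∉ palette c z) (hsa : s ≠ a) (h1 : Linked c r a x y) (h2 : Linked c s r y z) :
    False := by
  rcases F.unextendable c hc r s a (by grind) (by grind) hsa hr hsy haz with h | h | h
  · exact F.hxz (h.symm.end_unique hc.1 h2.swap (.inr hsy) (.inl hr) (.inl hrz) F.hxy.symm F.hyz)
  · exact not_linked_of_notMem F.hyz hsy hay h
  · exact F.not_linked_x_z hc h1 hr hay (.inl hrz) h

omit [Fintype K] F hc in
theorem _root_.IsColoringOf.recolor [DecidableEq V] {u w : V} (hc : IsColoringOf D c)
    (hn : c s(u, w) = some a)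
    (h : IsPartialAcyclic (Function.update (Function.update c s(u, w) none) s(u, w) (some t))) :
    IsColoringOf D (Function.update (Function.update c s(u, w) none) s(u, w) (some t)) := by
  refine ⟨h, fun e => ?_⟩
  have := hc.2 e
  by_cases he : e = s(u, w)
  · subst he
    simp [← hc.2, hn]
  · simpa [he] using this

theorem false_of_recolor_one [DecidableEq V] {n : V} {w p : K}
    (hX : ∀ γ ∈ palette c x, γ ∈ palette c z) (hZ : ∀ γ ∈ palette c z, γ ∈ palette c x ∨ γ = w)
    (hn : c s(z, n) = some a) (hnx : n ≠ x) (hny : n ≠ y)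
    (hXY : ∀ γ ∈ palette c x, γ ∉ palette c y) (ha : a ∈ palette c x)
    (h1 : ∀ r ∉ palette c x, Linked c r a x y)
    (h2 : ∀ s ∈ palette c x, s ≠ a → ∀ t ∉ palette c z, Linked c s t y z)
    (ht : t ∉ palette c z) (htn : t ∉ palette c n) (hwn : w ∉ palette c n)
    (hr : r ∉ palette c z) (hrt : r ≠ t) (hp : p ∈ palette c x) (hpa : p ≠ a) : False := by
  have hrx : r ∉ palette c x := fun h => hr (hX r h)
  have hra : r ≠ a := by grind
  have hrp : r ≠ p := by grind
  have hta : t ≠ a := by grind [mem_palette_left hn]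
  have hzn := hc.1.ne_of_some hn
  have hn0 : Function.update c s(z, n) none s(z, n) = none := Function.update_self ..
  have hpal : ∀ {m γ}, γ ∈ palette (Function.update (Function.update c s(z, n) none) s(z, n)
      (some t)) m ↔ (γ ∈ palette c m ∧ ¬ (γ = a ∧ (m = z ∨ m = n))) ∨
        (γ = t ∧ (m = z ∨ m = n)) := by
    intro m γ
    rw [mem_palette_insert hn0, mem_palette_erase hc.1 hn]
  have hc' := hc.recolor hn (t := t) ((hc.1.erase s(z, n)).insert hzn
    (by rw [mem_palette_erase hc.1 hn]; tauto) (by rw [mem_palette_erase hc.1 hn]; tauto) ?_)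
  · refine F.false_of_linked hc' (r := r) (s := p) (a := a) ?_ ?_ ?_ ?_ ?_ ?_ ?_ hpa
      (((h1 r hrx).erase_pendant hc.1 hn hr F.hxz.symm F.hyz.symm).insert hn0)
      (((h2 p hp hpa r hr).erase_of_ne hn hpa hra).insert hn0)
    all_goals rw [hpal]
    all_goals have hxz := F.hxz
    all_goals have hyz := F.hyz
    all_goals grind
  · intro β hβz hβn hl
    rw [mem_palette_erase hc.1 hn] at hβz hβn
    have hβa : β ≠ a := by tauto
    have hβx : β ∈ palette c x := (hZ β hβz.1).resolve_right (by rintro rfl; exact hwn hβn.1)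
    exact hny (hl.of_erase.end_unique hc.1 (h2 β hβx hβa t ht).symm.swap (.inl ht) (.inl htn)
      (.inr (hXY β hβx)) hzn F.hyz.symm)

theorem false_of_recolor_two [DecidableEq V] {n m : V} {w p u : K}
    (hX : ∀ γ ∈ palette c x, γ ∈ palette c z) (hZ : ∀ γ ∈ palette c z, γ ∈ palette c x ∨ γ = w)
    (hw : w ∉ palette c x) (hn : c s(z, n) = some a) (hnx : n ≠ x) (hny : n ≠ y)
    (hm : c s(z, m) = some w) (hmx : m ≠ x) (hmy : m ≠ y)
    (hXY : ∀ γ ∈ palette c x, γ ∉ palette c y) (ha : a ∈ palette c x)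
    (h1 : ∀ r ∉ palette c x, Linked c r a x y)
    (h2 : ∀ s ∈ palette c x, s ≠ a → ∀ t ∉ palette c z, Linked c s t y z)
    (ht : t ∉ palette c z) (htn : t ∉ palette c n) (htm : t ∉ palette c m)
    (hu : u ∉ palette c z) (hun : u ∉ palette c n) (hut : u ≠ t)
    (hr : r ∉ palette c z) (hrt : r ≠ t) (hru : r ≠ u)
    (hp : p ∈ palette c x) (hpa : p ≠ a) : False := by
  have hrx : r ∉ palette c x := fun h => hr (hX r h)
  have haz := mem_palette_left hn
  have hwz := mem_palette_left hm
  have hra : r ≠ a := by grind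
  have hrw : r ≠ w := by grind
  have hrp : r ≠ p := by grind
  have hta : t ≠ a := by grind
  have hua : u ≠ a := by grind
  have hwa : w ≠ a := by grind
  have hwp : w ≠ p := by grind
  have hzn := hc.1.ne_of_some hn
  have hzm := hc.1.ne_of_some hm
  have hnm : n ≠ m := by
    rintro rfl
    rw [hn] at hm
    exact hwa (Option.some_injective _ hm).symm
  have hnm' : s(z, n) ≠ s(z, m) := by simp; grind
  set c₁ := Function.update c s(z, n) none with hc₁
  have hA₁ : IsPartialAcyclic c₁ := hc.1.erase _
  have hm₁ : c₁ s(z, m) = some w := by rw [hc₁, Function.update_of_ne hnm'.symm, hm]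
  set c₂ := Function.update c₁ s(z, m) none with hc₂
  have hA₂ : IsPartialAcyclic c₂ := hA₁.erase _
  have hn₂ : c₂ s(z, n) = none := by rw [hc₂, Function.update_of_ne hnm', hc₁]; simp
  have hm₂ : c₂ s(z, m) = none := by simp [hc₂]
  set c₃ := Function.update c₂ s(z, m) (some t) with hc₃
  have hn₃ : c₃ s(z, n) = none := by rw [hc₃, Function.update_of_ne hnm', hn₂]
  have hpal₂ : ∀ {l γ}, γ ∈ palette c₂ l ↔ (γ ∈ palette c l ∧ ¬ (γ = a ∧ (l = z ∨ l = n))) ∧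
      ¬ (γ = w ∧ (l = z ∨ l = m)) := by
    intro l γ
    rw [mem_palette_erase hA₁ hm₁, mem_palette_erase hc.1 hn]
  have hpal₃ : ∀ {l γ}, γ ∈ palette c₃ l ↔ γ ∈ palette c₂ l ∨ (γ = t ∧ (l = z ∨ l = m)) :=
    mem_palette_insert hm₂
  have hz₂ : ∀ γ, γ ∈ palette c₂ z → γ ∈ palette c z ∧ γ ≠ a ∧ γ ≠ w := by
    intro γ hγ
    rw [hpal₂] at hγ
    exact ⟨hγ.1.1, fun h => hγ.1.2 ⟨h, .inl rfl⟩, fun h => hγ.2 ⟨h, .inl rfl⟩⟩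
  have hz₃ : ∀ γ, γ ∈ palette c₃ z → γ ∈ palette c z ∧ γ ≠ a ∧ γ ≠ w ∨ γ = t := by
    intro γ hγ
    rw [hpal₃] at hγ
    exact hγ.imp (hz₂ γ) And.left
  have hn₃' : ∀ γ, γ ∈ palette c₃ n → γ ∈ palette c n := by
    intro γ hγ
    rw [hpal₃, hpal₂] at hγ
    rcases hγ with h | ⟨-, h | h⟩
    exacts [h.1.1, absurd h.symm hzn, absurd h hnm]
  have hA₃ : IsPartialAcyclic c₃ := by
    refine hA₂.insert hzm (fun h => ht (hz₂ t h).1) (fun h => htm (hpal₂.1 h).1.1)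
      fun β hβz hβm hl => ?_
    obtain ⟨hβz, hβa, hβw⟩ := hz₂ β hβz
    have hβx : β ∈ palette c x := (hZ β hβz).resolve_right hβw
    exact hmy (hl.of_erase.of_erase.end_unique hc.1 (h2 β hβx hβa t ht).symm.swap (.inl ht)
      (.inl htm) (.inr (hXY β hβx)) hzm F.hyz.symm)
  have hA₄ : IsPartialAcyclic (Function.update c₃ s(z, n) (some u)) := by
    refine hA₃.insert hzn (fun h => (hz₃ u h).elim (fun h => hu h.1) hut)
      (fun h => hun (hn₃' u h)) fun β hβz hβn hl => ?_
    have hβn := hn₃' β hβn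
    have hβt : β ≠ t := fun h => htn (h ▸ hβn)
    obtain ⟨hβz, hβa, hβw⟩ := (hz₃ β hβz).resolve_right hβt
    have hβx : β ∈ palette c x := (hZ β hβz).resolve_right hβw
    exact hny ((hl.of_insert hut hβt).of_erase.of_erase.end_unique hc.1
      (h2 β hβx hβa u hu).symm.swap (.inl hu) (.inl hun) (.inr (hXY β hβx)) hzn F.hyz.symm)
  have hc₄ : IsColoringOf D (Function.update c₃ s(z, n) (some u)) := by
    refine ⟨hA₄, fun e => ?_⟩
    rw [← hc.2]
    by_cases hen : e = s(z, n)
    · simp [hen, hn]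
    · by_cases hem : e = s(z, m)
      · simp [hem, hnm'.symm, hm, hc₃]
      · simp [hen, hem, hc₃, hc₂, hc₁]
  refine F.false_of_linked hc₄ (r := r) (s := p) (a := a) ?_ ?_ ?_ ?_ ?_ ?_ ?_ hpa
    (((((h1 r hrx).erase_pendant hc.1 hn hr F.hxz.symm F.hyz.symm).erase_of_ne hm₁ hrw
      hwa.symm).insert hm₂).insert hn₃)
    (((((h2 p hp hpa r hr).erase_of_ne hn hpa hra).erase_of_ne hm₁ hwp.symm hrw).insert
      hm₂).insert hn₃)
  all_goals rw [mem_palette_insert hn₃, hpal₃, hpal₂]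
  all_goals have hxz := F.hxz
  all_goals have hyz := F.hyz
  all_goals grind

theorem false_of_recolor_swap [DecidableEq V] {n : V} {w u : K}
    (hX : ∀ γ ∈ palette c x, γ ∈ palette c z) (hZ : ∀ γ ∈ palette c z, γ ∈ palette c x ∨ γ = w)
    (hw : w ∉ palette c x) (hn : c s(z, n) = some w) (hnx : n ≠ x) (hny : n ≠ y)
    (hXY : ∀ γ ∈ palette c x, γ ∉ palette c y) (ha : a ∈ palette c x)
    (h1 : ∀ r ∉ palette c x, Linked c r a x y)
    (h2 : ∀ s ∈ palette c x, s ≠ a → ∀ t ∉ palette c z, Linked c s t y z)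
    (hnw : ∀ γ ∈ palette c n, γ = w ∨ γ ∉ palette c z)
    (hu : u ∉ palette c z) (hun : u ∉ palette c n) (hr : r ∉ palette c z) (hru : r ≠ u)
    (ht : t ∉ palette c z) (htu : t ≠ u) (hrt : r ≠ t) : False := by
  have hzn := hc.1.ne_of_some hn
  have hwz := mem_palette_left hn
  have hrx : r ∉ palette c x := fun h => hr (hX r h)
  have hux : u ∉ palette c x := fun h => hu (hX u h)
  have hrw : r ≠ w := by grind
  have hwu : w ≠ u := by grind
  have htw : t ≠ w := by grind
  have hwX : ∀ s ∈ palette c x, s ≠ w := by grind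
  have huX : ∀ s ∈ palette c x, s ≠ u := by grind
  set c₀ := Function.update c s(z, n) none with hc₀
  have hn₀ : c₀ s(z, n) = none := by simp [hc₀]
  have hA₀ : IsPartialAcyclic c₀ := hc.1.erase _
  have hpal₀ : ∀ {l γ}, γ ∈ palette c₀ l ↔ γ ∈ palette c l ∧ ¬ (γ = w ∧ (l = z ∨ l = n)) :=
    mem_palette_erase hc.1 hn
  have hz₀ : ∀ γ, γ ∈ palette c₀ z ↔ γ ∈ palette c x := by
    intro γ
    rw [hpal₀]
    have := hX γ
    have := hZ γ
    grind
  have hzn₀ : ∀ γ ∈ palette c₀ z, γ ∉ palette c₀ n := by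
    intro γ h h'
    rw [hz₀] at h
    exact (hnw γ (hpal₀.1 h').1).elim (hwX γ h) fun hγ => hγ (hX γ h)
  have hun₀ : u ∉ palette c₀ n := fun h => hun (hpal₀.1 h).1
  have huz₀ : u ∉ palette c₀ z := fun h => hu (hpal₀.1 h).1
  have hc₁ : IsColoringOf D (Function.update c₀ s(z, n) (some u)) :=
    hc.recolor hn (hA₀.insert hzn huz₀ hun₀ fun β h h' => absurd h' (hzn₀ β h))
  have hx₁ : ∀ γ, γ ∈ palette (Function.update c₀ s(z, n) (some u)) x ↔ γ ∈ palette c x := by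
    intro γ
    rw [mem_palette_insert hn₀, hpal₀]
    have := F.hxz
    grind
  have hy₁ : ∀ γ, γ ∈ palette (Function.update c₀ s(z, n) (some u)) y ↔ γ ∈ palette c y := by
    intro γ
    rw [mem_palette_insert hn₀, hpal₀]
    have := F.hyz
    grind
  have hz₁ : ∀ γ, γ ∈ palette (Function.update c₀ s(z, n) (some u)) z ↔
      γ ∈ palette c x ∨ γ = u := by
    intro γ
    rw [mem_palette_insert hn₀, hz₀]
    simp
  have hra₁ : Linked (Function.update c₀ s(z, n) (some u)) r a x y :=
    ((h1 r hrx).erase_of_ne hn hrw (hwX a ha)).insert hn₀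
  have hfull : ∀ s ∈ palette c x, s ≠ a → ∃ p, c s(z, p) = some s ∧
      ∀ γ, γ ∈ palette c p ↔ γ ∉ palette c x ∨ γ = s := by
    intro s hs hsa
    obtain ⟨p, hp⟩ := mem_palette.1 (hX s hs)
    refine ⟨p, hp, F.mem_palette_iff_of_forall hc hs (mem_palette_right hp) fun γ hγ => ?_⟩
    by_cases hγz : γ ∈ palette c z
    · obtain rfl := (hZ γ hγz).resolve_left hγ
      have h3 := F.linked_y_z hc₁ (a := a) (b := r) (by rwa [hx₁]) (by rw [hy₁]; exact hXY a ha)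
        (by rwa [hx₁]) (by rw [hz₁]; tauto)
        (fun h => F.not_linked_y_z hc₁ hra₁ (by rwa [hx₁]) (by rw [hy₁]; exact hXY a ha)
          (.inl (by rw [hz₁]; tauto)) h.swap) s (by rwa [hx₁]) hsa γ (by rw [hz₁]; tauto)
      have hzp : s(z, p) ≠ s(z, n) := by
        intro h
        rw [h, hn] at hp
        exact hwX s hs (Option.some_injective _ hp).symm
      have h4 := F.mem_palette_of_linked_y_z hc₁ (n := p) (s := s)
        (by rw [Function.update_of_ne hzp, hc₀, Function.update_of_ne hzp, hp])
        (by rw [hy₁]; exact hXY s hs) (by rw [hz₁]; tauto) h3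
      rw [mem_palette_insert hn₀, hpal₀] at h4
      tauto
    · exact F.mem_palette_of_linked_y_z hc hp (hXY s hs) hγz (h2 s hs hsa γ hγz)
  obtain ⟨p, hp, q, hq, hpq, hpa, hqa, -⟩ := F.exists_other_pair hc ha
  obtain ⟨P, hP, hPp⟩ := hfull p hp hpa
  obtain ⟨Q, hQ, hQq⟩ := hfull q hq hqa
  have hne : ∀ {s l}, s ∈ palette c x → c s(z, l) = some s → s(z, l) ≠ s(z, n) := by
    intro s l hs hl h
    rw [h, hn] at hl
    exact hwX s hs (Option.some_injective _ hl).symm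
  have hPn : P ≠ n := fun h => hne hp hP (by rw [h])
  have hQn : Q ≠ n := fun h => hne hq hQ (by rw [h])
  have hzP := hc.1.ne_of_some hP
  have hzQ := hc.1.ne_of_some hQ
  obtain ⟨c₂, hA₂, hdom, -, hpal, hpP, hlink⟩ := hA₀.exists_swap
    (by rw [hc₀, Function.update_of_ne (hne hp hP), hP])
    (by rw [hc₀, Function.update_of_ne (hne hq hQ), hQ]) hpq
    (fun β h hβ h' => by
      rw [hz₀] at h
      exact ((hPp β).1 (hpal₀.1 h').1).elim (fun h'' => h'' h) hβ)
    (fun β h hβ h' => by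
      rw [hz₀] at h
      exact ((hQq β).1 (hpal₀.1 h').1).elim (fun h'' => h'' h) hβ)
  have hn₂ : c₂ s(z, n) = none := (hdom _).2 hn₀
  have hz₂ := hpal z hzP hzQ
  have hn₂' := hpal n hPn.symm hQn.symm
  have hA₃ : IsPartialAcyclic (Function.update c₂ s(z, n) (some u)) :=
    hA₂.insert hzn (hz₂ ▸ huz₀) (hn₂' ▸ hun₀) fun β h h' =>
      absurd (hn₂' ▸ h') (hzn₀ β (hz₂ ▸ h))
  have hc₃ : IsColoringOf D (Function.update c₂ s(z, n) (some u)) := by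
    refine ⟨hA₃, fun e => ?_⟩
    rw [← hc.2]
    by_cases he : e = s(z, n)
    · simp [he, hn]
    · simp [he, hdom, hc₀]
  have hdx : d x + 3 ≤ Fintype.card K := by
    have := F.six_le
    rw [F.degree_x]
    omega
  have hxP := F.ne_of_mem_palette_iff hc hp hPp hdx
  have hxQ := F.ne_of_mem_palette_iff hc hq hQq hdx
  have hyP := F.ne_of_mem_palette_iff hc hp hPp F.degree_y
  have hyQ := F.ne_of_mem_palette_iff hc hq hQq F.degree_y
  have hx₃ : ∀ γ, γ ∈ palette (Function.update c₂ s(z, n) (some u)) x ↔ γ ∈ palette c x := by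
    intro γ
    rw [mem_palette_insert hn₂, hpal x hxP hxQ, hpal₀]
    have := F.hxz
    grind
  have hy₃ : ∀ γ, γ ∈ palette (Function.update c₂ s(z, n) (some u)) y ↔ γ ∈ palette c y := by
    intro γ
    rw [mem_palette_insert hn₂, hpal y hyP hyQ, hpal₀]
    have := F.hyz
    grind
  have hz₃ : ∀ γ, γ ∈ palette (Function.update c₂ s(z, n) (some u)) z ↔
      γ ∈ palette c x ∨ γ = u := by
    intro γ
    rw [mem_palette_insert hn₂, hz₂, hz₀]
    simp
  have hP₃ : p ∉ palette (Function.update c₂ s(z, n) (some u)) P := by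
    rw [mem_palette_insert hn₂]
    exact fun h => h.elim hpP fun h => huX p hp h.1
  have htx : t ∉ palette c x := fun h => ht (hX t h)
  have hl₃ : ∀ s, s ∉ palette c z → Linked (Function.update c₂ s(z, n) (some u)) s p y P := by
    intro s hs
    have hsx : s ∉ palette c x := fun h => hs (hX s h)
    exact (hlink s y (by rintro rfl; exact hsx hp) (by rintro rfl; exact hsx hq)
      (by rwa [hz₀]) F.hyz
      ((h2 p hp hpa s hs).swap.erase_of_ne hn (by rintro rfl; exact hs hwz) (hwX p hp))).insert
        hn₂
  have hpy₃ : p ∉ palette (Function.update c₂ s(z, n) (some u)) y := by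
    rw [hy₃]
    exact hXY p hp
  rcases F.unextendable _ hc₃ r p t (by grind) hrt (by grind) (by rwa [hx₃]) hpy₃
    (by rw [hz₃]; tauto) with h | h | h
  · exact hxP (h.symm.end_unique hA₃ (hl₃ r hr) (.inr hpy₃) (.inl (by rwa [hx₃])) (.inr hP₃)
      F.hxy.symm hyP)
  · exact hzP (h.swap.end_unique hA₃ (hl₃ t ht) (.inr hpy₃) (.inl (by rw [hz₃]; tauto))
      (.inr hP₃) F.hyz hyP)
  · exact not_linked_of_notMem F.hxz (by rwa [hx₃]) (by rwa [hx₃]) h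

theorem largeNeighbors_z_three [DecidableEq V] (ha : a ∈ palette c x) (hay : a ∉ palette c y)
    (hb : b ∉ palette c x) (hbz : b ∉ palette c z) (hab : ¬ Linked c a b y z) (hdz : d z = 4) :
    LargeNeighbors c x d z 3 := by
  classical
  have hY := F.mem_palette_y_iff hc ha hay hb hbz hab
  have hX := F.mem_palette_z hc ha hay hb hbz hab
  have h1 := F.linked_x_y hc ha hay hX hbz hab
  have h2 := F.linked_y_z hc ha hay hb hbz hab
  have hXY : ∀ γ ∈ palette c x, γ ∉ palette c y := fun γ hγ => by simpa [hY] using hγ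
  have hcx := F.card_palette c hc x
  have hcy := F.card_palette c hc y
  have hcz := F.card_palette c hc z
  have hdx := F.degree_x
  have hz3 := F.degree_z
  obtain ⟨w, hw⟩ : ∃ w, palette c z \ palette c x = {w} := by
    rw [← Finset.card_eq_one, Finset.card_sdiff_of_subset hX]
    omega
  have hZ : ∀ γ ∈ palette c z, γ ∈ palette c x ∨ γ = w := fun γ hγ => by
    have := (Finset.ext_iff.1 hw γ).1
    grind
  have hwz : w ∈ palette c z ∧ w ∉ palette c x := by
    have := (Finset.ext_iff.1 hw w).2
    grind
  obtain ⟨hwz, hwx⟩ := hwz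
  have haz := hX a ha
  have hwa : w ≠ a := by grind
  obtain ⟨n, hn⟩ := mem_palette.1 haz
  obtain ⟨m, hm⟩ := mem_palette.1 hwz
  by_contra hcon
  have hbig := F.four_le_degree_neighbor_z hc ha hay hb hbz hab
  have hnd : ¬ (n = x ∨ 4 ≤ d n) := fun h => by
    refine hcon ⟨palette c x, by omega, fun γ hγ => ?_⟩
    by_cases hγa : γ = a
    · exact ⟨n, hγa ▸ hn, h⟩
    · obtain ⟨l, hl, hl'⟩ := hbig γ hγ hγa
      exact ⟨l, hl, .inr hl'⟩
  have hmd : ¬ (m = x ∨ 4 ≤ d m) := fun h => by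
    refine hcon ⟨insert w ((palette c x).erase a), ?_, fun γ hγ => ?_⟩
    · rw [Finset.card_insert_of_notMem (by simp [hwx]), Finset.card_erase_of_mem ha]
      omega
    · by_cases hγw : γ = w
      · exact ⟨m, hγw ▸ hm, h⟩
      · obtain ⟨l, hl, hl'⟩ := hbig γ (by grind) (by grind)
        exact ⟨l, hl, .inr hl'⟩
  push Not at hnd hmd
  have hdy : 4 ≤ d y := by
    have : palette c y = (palette c x)ᶜ := by
      ext γ
      simp [hY]
    rw [this, Finset.card_compl] at hcy
    omega
  have hny : n ≠ y := by
    rintro rfl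
    omega
  have hmy : m ≠ y := by
    rintro rfl
    omega
  obtain ⟨p, hp, -, -, -, hpa, -, -⟩ := F.exists_other_pair hc ha
  have hna : ((palette c n).erase a).card ≤ 2 := by
    rw [Finset.card_erase_of_mem (mem_palette_right hn), F.card_palette c hc]
    omega
  have hmw : ((palette c m).erase w).card ≤ 2 := by
    rw [Finset.card_erase_of_mem (mem_palette_right hm), F.card_palette c hc]
    omega
  by_cases hwn : w ∈ palette c n
  swap
  · obtain ⟨t, ht, htn⟩ := Finset.exists_notMem_of_card_lt (palette c z) ((palette c n).erase a)
      (by omega)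
    obtain ⟨r, hr, hrt, -⟩ := F.exists_notMem_z hc t t
    exact F.false_of_recolor_one hc hX hZ hn hnd.1 hny hXY ha h1 h2 ht (by grind) hwn hr hrt hp hpa
  have hnaw : (((palette c n).erase a).erase w).card ≤ 1 := by
    rw [Finset.card_erase_of_mem (by simp [hwn, hwa])]
    omega
  by_cases hT : ∃ t, t ∉ palette c z ∧ t ∉ palette c n ∧ t ∉ palette c m
  · obtain ⟨t, ht, htn, htm⟩ := hT
    have := Finset.card_insert_le t (((palette c n).erase a).erase w)
    obtain ⟨u, hu, hun⟩ := Finset.exists_notMem_of_card_lt (palette c z)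
      (insert t (((palette c n).erase a).erase w)) (by omega)
    obtain ⟨r, hr, hrt, hru⟩ := F.exists_notMem_z hc t u
    exact F.false_of_recolor_two hc hX hZ hwx hn hnd.1 hny hm hmd.1 hmy hXY ha h1 h2 ht htn htm hu
      (by grind) (by grind) hr hrt hru hp hpa
  push Not at hT
  obtain ⟨u, hu, hum⟩ := Finset.exists_notMem_of_card_lt (palette c z) ((palette c m).erase w)
    (by omega)
  obtain ⟨r, hr, hru, -⟩ := F.exists_notMem_z hc u u
  obtain ⟨t, ht, htu, htr⟩ := F.exists_notMem_z hc u r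
  refine F.false_of_recolor_swap hc hX hZ hwx hm hmd.1 hmy hXY ha h1 h2 (fun γ hγ => ?_) hu
    (by grind) hr hru ht htu htr.symm
  by_contra! hcon'
  have h3 : (((palette c m).erase w).erase γ).card ≤ 1 := by
    rw [Finset.card_erase_of_mem (by simp [hγ, hcon'.1])]
    omega
  have h4 := Finset.card_union_le (((palette c n).erase a).erase w)
    (((palette c m).erase w).erase γ)
  obtain ⟨t', ht', htn⟩ := Finset.exists_notMem_of_card_lt (palette c z)
    ((((palette c n).erase a).erase w) ∪ (((palette c m).erase w).erase γ)) (by omega)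
  grind

theorem largeNeighbors_of_notMem [DecidableEq V] (ha : a ∈ palette c x) (hay : a ∉ palette c y)
    (hb : b ∉ palette c x) (hbz : b ∉ palette c z) (hab : ¬ Linked c a b y z) :
    LargeNeighbors c x d y 3 ∧ LargeNeighbors c x d z 2 ∧
      (d z = 4 → LargeNeighbors c x d z 3) :=
  ⟨F.largeNeighbors_y hc ha hay hb hbz hab, F.largeNeighbors_z hc ha hay hb hbz hab,
    F.largeNeighbors_z_three hc ha hay hb hbz hab⟩

theorem false_of_forall_linked [DecidableEq V]
    (hY : ∀ γ, γ ∈ palette c x → γ ∉ palette c y) (hZ : ∀ γ, γ ∈ palette c x → γ ∉ palette c z)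
    (h : ∀ r ∉ palette c x, ∀ s ∈ palette c x, Linked c r s x y ∨ Linked c r s x z)
    (hr : r ∉ palette c x) (h' : ∀ s ∈ palette c x, Linked c r s x y) : False := by
  obtain ⟨t, ht⟩ : (palette c x).Nonempty := by
    rw [← Finset.card_pos, F.card_palette c hc, F.degree_x]
    omega
  obtain ⟨p, hp, q, hq, hpq, hpt, hqt, -⟩ := F.exists_other_pair hc ht
  have hfull : ∀ s ∈ palette c x, ∀ r ∉ palette c x,
      ∃ w, w ≠ x ∧ s ∉ palette c w ∧ Linked c r s x w := fun s hs r hr =>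
    (h r hr s hs).elim (fun h => ⟨y, F.hxy.symm, hY s hs, h⟩)
      fun h => ⟨z, F.hxz.symm, hZ s hs, h⟩
  obtain ⟨n, hn⟩ := mem_palette.1 hp
  obtain ⟨m, hm⟩ := mem_palette.1 hq
  exact F.false_of_swap hc hpq hn hm (F.mem_palette_neighbor_iff hc hn (hfull p hp))
    (F.mem_palette_neighbor_iff hc hm (hfull q hq)) (hY p hp) (hZ t ht) hr
    (by rintro rfl; exact hr ht) hpt.symm hqt.symm (h' p hp) (.inr ⟨hY t ht, h' t ht⟩)

theorem mem_palette_z_of_forall_notMem (h : ∀ t ∉ palette c z, t ∈ palette c x) :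
    ∀ γ ∈ palette c x, γ ∉ palette c z := by
  classical
  have hsub : (palette c z)ᶜ ⊆ palette c x := fun t ht => h t (Finset.mem_compl.1 ht)
  have h1 := F.card_palette c hc x
  have h2 := F.card_palette c hc z
  have h3 := F.degree_x
  have h4 := F.degree_z
  have heq := Finset.eq_of_subset_of_card_le hsub (by rw [Finset.card_compl]; omega)
  intro γ hγ
  rwa [← heq, Finset.mem_compl] at hγ

theorem false_of_forall_notMem [DecidableEq V] (hY : ∀ γ ∉ palette c y, γ ∈ palette c x)
    (hZ : ∀ γ ∉ palette c z, γ ∈ palette c x) : False := by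
  have hY' := F.symm.mem_palette_z_of_forall_notMem hc hY
  have hZ' := F.mem_palette_z_of_forall_notMem hc hZ
  have hmain : ∀ s ∈ palette c x, ∀ t ∈ palette c x, s ≠ t → ∀ r ∉ palette c x,
      Linked c r s x y ∨ Linked c r t x z := fun s hs t ht hst r hr =>
    F.linked_of_mem hc (hY' s hs) hs (hZ' t ht) ht hst
      (not_linked_of_notMem F.hyz (hY' s hs) (hY' t ht)) hr
  have hall : ∀ r ∉ palette c x, ∀ s ∈ palette c x, Linked c r s x y ∨ Linked c r s x z := by
    intro r hr s hs
    by_contra! hcon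
    obtain ⟨t, ht, -, -, -, hts, -, -⟩ := F.exists_other_pair hc hs
    exact F.not_linked_x_z hc ((hmain t ht s hs hts r hr).resolve_right hcon.2) hr (hY' t ht)
      (.inr (hZ' t ht)) ((hmain s hs t ht hts.symm r hr).resolve_left hcon.1)
  obtain ⟨r, hr, -⟩ := Finset.exists_notMem_of_card_lt (palette c x) ∅ (by
    have := F.card_palette c hc x
    have := F.degree_x
    have := F.six_le
    rw [Finset.card_empty]
    omega)
  by_cases h : ∀ s ∈ palette c x, Linked c r s x y
  · exact F.false_of_forall_linked hc hY' hZ' hall hr h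
  · push Not at h
    obtain ⟨s, hs, hsr⟩ := h
    refine F.symm.false_of_forall_linked hc hZ' hY' (fun r hr s hs => (hall r hr s hs).symm) hr
      fun t ht => ?_
    by_cases hst : s = t
    · exact (hall r hr t ht).resolve_left (hst ▸ hsr)
    · exact (hmain s hs t ht hst r hr).resolve_left hsr

theorem not_linked_of_mem (hs : s ∈ palette c x) (hsy : s ∉ palette c y) (ht : t ∈ palette c x)
    (htz : t ∉ palette c z) (hst : s ≠ t) (hl : ¬ Linked c s t y z) {t' : K}
    (ht' : t' ∉ palette c z) (htx : t' ∉ palette c x) : ¬ Linked c s t' y z := fun h => by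
  rcases F.linked_of_mem hc hsy hs htz ht hst hl htx with h' | h'
  · exact F.not_linked_y_z hc h' htx hsy (.inl ht') h.swap
  · exact not_linked_of_notMem F.hxz.symm ht' htz h'.symm

/-- The existence of many neighbors of large degree. -/
theorem largeNeighbors [DecidableEq V] (hsy : s ∉ palette c y) (htz : t ∉ palette c z)
    (hst : s ≠ t) (hl : ¬ Linked c s t y z) :
    (LargeNeighbors c x d y 3 ∧ LargeNeighbors c x d z 2 ∧
      (d z = 4 → LargeNeighbors c x d z 3)) ∨
    (LargeNeighbors c x d z 3 ∧ LargeNeighbors c x d y 2 ∧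
      (d y = 4 → LargeNeighbors c x d y 3)) := by
  have hl' : ¬ Linked c t s z y := fun h => hl h.symm.swap
  by_cases hs : s ∈ palette c x <;> by_cases ht : t ∈ palette c x
  · by_cases hZ : ∀ γ ∉ palette c z, γ ∈ palette c x
    · by_cases hY : ∀ γ ∉ palette c y, γ ∈ palette c x
      · exact (F.false_of_forall_notMem hc hY hZ).elim
      · push Not at hY
        obtain ⟨s', hs', hs'x⟩ := hY
        exact .inr (F.symm.largeNeighbors_of_notMem hc ht htz hs'x hs'
          (F.symm.not_linked_of_mem hc ht htz hs hsy hst.symm hl' hs' hs'x))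
    · push Not at hZ
      obtain ⟨t', ht', ht'x⟩ := hZ
      exact .inl (F.largeNeighbors_of_notMem hc hs hsy ht'x ht'
        (F.not_linked_of_mem hc hs hsy ht htz hst hl ht' ht'x))
  · exact .inl (F.largeNeighbors_of_notMem hc hs hsy ht htz hl)
  · exact .inr (F.symm.largeNeighbors_of_notMem hc ht htz hs hsy hl')
  · exact absurd (F.linked_of_notMem hc hsy htz hst hs ht) hl

end IsObstruction

end Obstruction

section Extend

variable {V K : Type*} {c : Sym2 V → Option K} {α β γ r s t : K} {v x y z : V}

open Classical in
/-- The coloring of the edges of `H`, with all other pairs of vertices left uncolored. -/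
noncomputable def partialColoring (H : SimpleGraph V) (f : Sym2 V → K) (e : Sym2 V) : Option K :=
  if e ∈ H.edgeSet then some (f e) else none

theorem partialColoring_eq_some {H : SimpleGraph V} {f : Sym2 V → K} {e : Sym2 V} :
    partialColoring H f e = some α ↔ e ∈ H.edgeSet ∧ f e = α := by
  simp [partialColoring]

theorem IsAcyclicEdgeColoring.isPartialAcyclic {H : SimpleGraph V} {f : Sym2 V → K}
    (hf : IsAcyclicEdgeColoring H f) : IsPartialAcyclic (partialColoring H f) where
  loopless u := by simp [partialColoring]
  proper u w w' α hw hw' := by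
    rw [partialColoring_eq_some] at hw hw'
    by_contra hne
    exact hf.1 _ hw.1 _ hw'.1 (by simp; grind) ⟨u, by simp⟩ (hw.2.trans hw'.2.symm)
  acyclic α β := by
    have hle : bicolored (partialColoring H f) α β ≤ H := by
      rintro u w ⟨-, h | h⟩ <;> exact (partialColoring_eq_some.1 h).1
    intro u p hp
    refine hf.2 u (p.mapLe hle) (hp.mapLe hle) ⟨α, β, fun e he => ?_⟩
    rw [Walk.edges_mapLe_eq_edges] at he
    have := p.edges_subset_edgeSet he
    induction e with
    | h u w =>
      exact this.2.imp (fun h => (partialColoring_eq_some.1 h).2) (fun h =>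
        (partialColoring_eq_some.1 h).2)

theorem IsPartialAcyclic.acyclicEdgeColorable {k : ℕ} [NeZero k] {G : SimpleGraph V}
    {c : Sym2 V → Option (Fin k)} (hc : IsPartialAcyclic c)
    (hG : ∀ e ∈ G.edgeSet, c e ≠ none) : AcyclicEdgeColorable G k := by
  have hval : ∀ e ∈ G.edgeSet, c e = some ((c e).getD 0) := fun e he => by
    obtain ⟨α, hα⟩ := Option.ne_none_iff_exists'.1 (hG e he)
    simp [hα]
  refine ⟨fun e => (c e).getD 0, ?_, fun u p hp => ?_⟩
  · rintro e₁ h₁ e₂ h₂ hne ⟨u, hu₁, hu₂⟩ heq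
    obtain ⟨w₁, rfl⟩ := Sym2.mem_iff_exists.1 hu₁
    obtain ⟨w₂, rfl⟩ := Sym2.mem_iff_exists.1 hu₂
    refine hne (congrArg _ (hc.proper u w₁ w₂ _ (hval _ h₁) ?_))
    rw [hval _ h₂]
    exact congrArg _ heq.symm
  · rintro ⟨a, b, hab⟩
    have hp' : ∀ e ∈ p.edges, e ∈ (bicolored c a b).edgeSet := by
      intro e he
      have heG := p.edges_subset_edgeSet he
      have := hval e heG
      induction e with
      | h u w =>
        exact ⟨G.ne_of_adj heG, (hab _ he).imp (fun h => this.trans (congrArg _ h))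
          fun h => this.trans (congrArg _ h)⟩
    exact hc.acyclic a b _ (hp.transfer hp')

variable [Fintype K] [DecidableEq V]

theorem not_linked_insert (hn : c s(v, x) = none) (hα : α ∉ palette c v) (hβ : β ∉ palette c v)
    (hyv : y ≠ v) (h : ¬ Linked c α β y x) :
    ¬ Linked (Function.update c s(v, x) (some γ)) α β v y := by
  intro h'
  have := h'.symm.erase x
  rw [Function.update_idem, Function.update_eq_self_iff.2 hn.symm] at this
  exact this.elim (fun h => not_linked_of_notMem hyv.symm hα hβ h.symm) h

/-- Three edges from an isolated vertex `v` to the distinct vertices `x`, `y` and `z` can be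
given colors `r`, `s` and `t`. -/
theorem IsPartialAcyclic.insert_three (hc : IsPartialAcyclic c) (hv : ∀ w, c s(v, w) = none)
    (hvx : v ≠ x) (hvy : v ≠ y) (hvz : v ≠ z) (hxy : x ≠ y)
    (hrs : r ≠ s) (hrt : r ≠ t) (hst : s ≠ t)
    (hr : r ∉ palette c x) (hs : s ∉ palette c y) (ht : t ∉ palette c z)
    (h1 : ¬ Linked c r s x y) (h2 : ¬ Linked c s t y z) (h3 : ¬ Linked c r t x z) :
    IsPartialAcyclic (Function.update (Function.update (Function.update c s(v, x) (some r))
      s(v, y) (some s)) s(v, z) (some t)) := by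
  have hpv : ∀ γ, γ ∉ palette c v := fun γ h => by
    obtain ⟨w, hw⟩ := mem_palette.1 h
    simp [hv] at hw
  set c₁ := Function.update c s(v, x) (some r) with hc₁
  have hA₁ : IsPartialAcyclic c₁ := hc.insert hvx (hpv r) hr fun β h => absurd h (hpv β)
  have hp₁ : ∀ {l γ}, γ ∈ palette c₁ l ↔ γ ∈ palette c l ∨ (γ = r ∧ (l = v ∨ l = x)) :=
    mem_palette_insert (hv x)
  have hpv₁ : ∀ γ, γ ∈ palette c₁ v ↔ γ = r := fun γ => by simp [hp₁, hpv]
  have hy₁ : c₁ s(v, y) = none := by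
    rw [hc₁, Function.update_of_ne (by simp; grind), hv]
  set c₂ := Function.update c₁ s(v, y) (some s) with hc₂
  have hA₂ : IsPartialAcyclic c₂ := by
    refine hA₁.insert hvy (by simp [hpv₁, hrs.symm]) (by rw [hp₁]; grind) fun β hβ _ => ?_
    obtain rfl := (hpv₁ β).1 hβ
    exact not_linked_insert (hv x) (hpv _) (hpv _) hvy.symm fun h => h1 h.symm.swap
  have hp₂ : ∀ {l γ}, γ ∈ palette c₂ l ↔ γ ∈ palette c₁ l ∨ (γ = s ∧ (l = v ∨ l = y)) :=
    mem_palette_insert hy₁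
  have hpv₂ : ∀ γ, γ ∈ palette c₂ v ↔ γ = r ∨ γ = s := fun γ => by simp [hp₂, hpv₁]
  refine hA₂.insert hvz (by simp [hpv₂, hrt.symm, hst.symm]) (by rw [hp₂, hp₁]; grind)
    fun β hβ _ h => ?_
  rcases (hpv₂ β).1 hβ with rfl | rfl
  · exact not_linked_insert (hv x) (hpv _) (hpv _) hvz.symm (fun h => h3 h.symm.swap)
      (h.of_insert hst.symm hrs)
  · exact not_linked_insert hy₁ (by simp [hpv₁, hrt.symm]) (by simp [hpv₁, hrs.symm]) hvz.symm
      (fun h => h2 ((h.of_insert hrt.symm hrs.symm).symm.swap)) h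

end Extend

section Critical

variable {V : Type*} [Fintype V] [DecidableEq V] {G : SimpleGraph V} [DecidableRel G.Adj]
  {v x y z : V}

/-- The number of neighbors of `n` other than `v`, or zero for `n = v`. -/
def degreeAvoiding (G : SimpleGraph V) [DecidableRel G.Adj] (v n : V) : ℕ :=
  (Finset.univ.filter fun w => G.Adj n w ∧ v ≠ n ∧ v ≠ w).card

/-- The edges of `G` which are not incident to `v`. -/
def edgesAvoiding (G : SimpleGraph V) (v : V) : Set (Sym2 V) :=
  {e | e ∈ G.edgeSet ∧ v ∉ e}

theorem degreeAvoiding_le (n : V) : degreeAvoiding G v n ≤ G.degree n :=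
  Finset.card_le_card fun w hw => by simp_all

theorem degreeAvoiding_add_one {n : V} (h : G.Adj v n) : degreeAvoiding G v n + 1 = G.degree n := by
  have : (Finset.univ.filter fun w => G.Adj n w ∧ v ≠ n ∧ v ≠ w) =
      (G.neighborFinset n).erase v := by
    ext w
    have := h.ne
    simp
    tauto
  rw [degreeAvoiding, this, Finset.card_erase_add_one (by simpa using h.symm),
    card_neighborFinset_eq_degree]

theorem IsColoringOf.card_palette {K : Type*} [Fintype K] {c : Sym2 V → Option K}
    (hc : IsColoringOf (edgesAvoiding G v) c) (n : V) :
    (palette c n).card = degreeAvoiding G v n := by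
  classical
  have hdom : ∀ w, (∃ γ, c s(n, w) = some γ) ↔ G.Adj n w ∧ v ≠ n ∧ v ≠ w := fun w => by
    rw [← Option.ne_none_iff_exists', ne_eq, hc.2]
    simp [edgesAvoiding]
  rw [← Finset.card_map Function.Embedding.some, degreeAvoiding,
    ← Finset.card_image_of_injOn (f := fun w => c s(n, w))]
  · congr 1
    ext o
    simp only [Finset.mem_map, mem_palette, Finset.mem_image, Finset.mem_filter,
      Finset.mem_univ, true_and, ← hdom, Function.Embedding.some_apply]
    grind
  · intro w hw w' hw' h
    simp only [Finset.coe_filter, Finset.mem_univ, true_and, Set.mem_ofPred_eq, ← hdom] at hw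
    obtain ⟨γ, hγ⟩ := hw
    exact hc.1.proper n w w' γ hγ (h.symm.trans hγ)

theorem eq_of_adj_of_degree_eq_three (hv : G.degree v = 3) (hx : G.Adj v x) (hy : G.Adj v y)
    (hz : G.Adj v z) (hxy : x ≠ y) (hxz : x ≠ z) (hyz : y ≠ z) {w : V} (hw : G.Adj v w) :
    w = x ∨ w = y ∨ w = z := by
  have hsub : {x, y, z} ⊆ G.neighborFinset v := by
    intro n hn
    simp only [Finset.mem_insert, Finset.mem_singleton] at hn
    rw [mem_neighborFinset]
    rcases hn with rfl | rfl | rfl <;> assumption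
  have heq := Finset.eq_of_subset_of_card_le hsub (by
    rw [card_neighborFinset_eq_degree, hv, Finset.card_eq_three.2 ⟨x, y, z, hxy, hxz, hyz, rfl⟩])
  simpa [← heq] using (G.mem_neighborFinset v w).2 hw

theorem IsAcyclicallyEdgeCritical.isObstruction
    (hG : IsAcyclicallyEdgeCritical G (G.maxDegree + 2)) (hv : G.degree v = 3) (hx : G.Adj v x)
    (hy : G.Adj v y) (hz : G.Adj v z) (hxy : x ≠ y) (hxz : x ≠ z) (hyz : y ≠ z)
    (hdx : G.degree x = 4) :
    IsObstruction (Fin (G.maxDegree + 2)) (edgesAvoiding G v) x y z (degreeAvoiding G v) where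
  hxy := hxy
  hxz := hxz
  hyz := hyz
  unextendable c hc r s t hrs hrt hst hr hs ht := by
    by_contra! h
    refine hG.1 (IsPartialAcyclic.acyclicEdgeColorable (hc.1.insert_three (v := v) (fun w => ?_)
      hx.ne hy.ne hz.ne hxy hrs hrt hst hr hs ht h.1 h.2.1 h.2.2) fun e he => ?_)
    · simp [hc.2, edgesAvoiding]
    · by_cases hve : v ∈ e
      · obtain ⟨w, rfl⟩ := Sym2.mem_iff_exists.1 hve
        rcases eq_of_adj_of_degree_eq_three hv hx hy hz hxy hxz hyz he with rfl | rfl | rfl <;>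
          simp [Function.update_apply] <;> grind
      · have h1 : ∀ w, e ≠ s(v, w) := by
          rintro w rfl
          simp at hve
        simp [Function.update_of_ne (h1 _), hc.2, edgesAvoiding, he, hve]
  card_palette c hc := hc.card_palette
  degree_x := by
    have := degreeAvoiding_add_one hx
    omega
  degree_y := by
    have := degreeAvoiding_add_one hy
    have := G.degree_le_maxDegree y
    simp only [Fintype.card_fin]
    omega
  degree_z := by
    have := degreeAvoiding_add_one hz
    have := G.degree_le_maxDegree z
    simp only [Fintype.card_fin]
    omega
  degree_le n := by
    have := degreeAvoiding_le (G := G) (v := v) n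
    have := G.degree_le_maxDegree n
    simp only [Fintype.card_fin]
    omega
  six_le := by
    have := G.degree_le_maxDegree x
    simp only [Fintype.card_fin]
    omega

omit [Fintype V] in
theorem exists_isColoringOf {k : ℕ} (hG : ∀ H : SimpleGraph V, H < G → AcyclicEdgeColorable H k)
    (hx : G.Adj v x) (hy : G.Adj v y) (hz : G.Adj v z) (hxy : x ≠ y) (hxz : x ≠ z) (hyz : y ≠ z) :
    ∃ c : Sym2 V → Option (Fin k), IsColoringOf (edgesAvoiding G v) c ∧ ∃ s t, s ≠ t ∧
      s ∉ palette c y ∧ t ∉ palette c z ∧ ¬ Linked c s t y z := by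
  classical
  obtain ⟨f, hf⟩ := hG (G.deleteEdges {s(v, x)}) (lt_of_le_of_ne (deleteEdges_le _) fun h => by
    rw [← h] at hx
    simp at hx)
  have hf' := hf.isPartialAcyclic
  set b := partialColoring (G.deleteEdges {s(v, x)}) f with hb
  have hby : b s(v, y) = some (f s(v, y)) := by
    simp [hb, partialColoring_eq_some, hy, hxy.symm, hx.ne]
  have hbz : b s(v, z) = some (f s(v, z)) := by
    simp [hb, partialColoring_eq_some, hz, hxz.symm, hx.ne]
  have hle : ∀ e α, (if v ∈ e then none else b e) = some α → v ∉ e ∧ b e = some α := by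
    intro e α h
    split_ifs at h with hve
    exact ⟨hve, h⟩
  refine ⟨fun e => if v ∈ e then none else b e, ⟨hf'.of_le fun e α h => (hle e α h).2,
    fun e => ?_⟩, f s(v, y), f s(v, z), fun h => ?_, fun h => ?_, fun h => ?_, fun h => ?_⟩
  · by_cases hve : v ∈ e
    · simp [hve, edgesAvoiding]
    · have : e ≠ s(v, x) := by
        rintro rfl
        simp at hve
      simp [hve, edgesAvoiding, hb, partialColoring, this]
  · exact hyz (hf'.proper v y z _ hby (h ▸ hbz))
  · obtain ⟨w, hw⟩ := mem_palette.1 h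
    obtain ⟨hvw, hw⟩ := hle _ _ hw
    have hyv := (congrArg b Sym2.eq_swap).trans hby
    exact hvw (by simp [hf'.proper y v w _ hyv hw])
  · obtain ⟨w, hw⟩ := mem_palette.1 h
    obtain ⟨hvw, hw⟩ := hle _ _ hw
    have hzv := (congrArg b Sym2.eq_swap).trans hbz
    exact hvw (by simp [hf'.proper z v w _ hzv hw])
  · have hbridge := isAcyclic_iff_forall_adj_isBridge.1 (hf'.acyclic (f s(v, y)) (f s(v, z)))
      (v := v) (w := y) ⟨hy.ne, .inl hby⟩
    refine isBridge_iff.1 hbridge (Reachable.trans (v := z) (Adj.reachable ?_)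
      (Reachable.mono ?_ h.symm))
    · rw [deleteEdges_adj]
      exact ⟨⟨hz.ne, .inr hbz⟩, by simp [hyz.symm, hy.ne]⟩
    · rintro u w ⟨huw, h⟩
      rw [deleteEdges_adj]
      refine ⟨⟨huw, h.imp (fun h => (hle _ _ h).2) fun h => (hle _ _ h).2⟩, fun h' => ?_⟩
      rw [Set.mem_singleton_iff] at h'
      rcases h with h | h <;> exact (hle _ _ h).1 (by simp [h'])

theorem LargeNeighbors.le_card {K : Type*} [Fintype K] {c : Sym2 V → Option K} {u : V} {m : ℕ}
    (hc : IsColoringOf (edgesAvoiding G v) c) (hdx : G.degree x = 4)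
    (h : LargeNeighbors c x (degreeAvoiding G v) u m) :
    m ≤ ((G.neighborFinset u).filter fun w => 4 ≤ G.degree w).card := by
  obtain ⟨A, hA, h⟩ := h
  have : Nonempty V := ⟨u⟩
  choose! g hg hd using h
  refine hA.trans (Finset.card_le_card_of_injOn g (fun γ hγ => ?_) fun γ hγ γ' hγ' heq => ?_)
  · have h1 : s(u, g γ) ∈ edgesAvoiding G v := by
      by_contra h1
      simpa [(hc.2 _).2 h1] using hg γ hγ
    have h2 := degreeAvoiding_le (G := G) (v := v) (g γ)
    have h3 := hd γ hγ
    simp only [Finset.coe_filter, mem_neighborFinset, Set.mem_ofPred_eq]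
    refine ⟨h1.1, h3.elim (fun h => ?_) fun h => h.trans h2⟩
    rw [h, hdx]
  · have h1 := hg γ hγ
    simp only [heq] at h1
    exact Option.some_injective _ (h1.symm.trans (hg γ' hγ'))

end Critical

theorem stmt12 {V : Type*} [Fintype V] [DecidableEq V] (G : SimpleGraph V) [DecidableRel G.Adj]
    (hG : IsAcyclicallyEdgeCritical G (G.maxDegree + 2))
    (v x y z : V) (hv : G.degree v = 3)
    (hx : G.Adj v x) (hy : G.Adj v y) (hz : G.Adj v z)
    (hxy : x ≠ y) (hxz : x ≠ z) (hyz : y ≠ z)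
    (hdx : G.degree x = 4) :
    (3 ≤ ((G.neighborFinset y).filter fun w => 4 ≤ G.degree w).card ∧
      2 ≤ ((G.neighborFinset z).filter fun w => 4 ≤ G.degree w).card ∧
      (G.degree z = 5 → 3 ≤ ((G.neighborFinset z).filter fun w => 4 ≤ G.degree w).card)) ∨
    (3 ≤ ((G.neighborFinset z).filter fun w => 4 ≤ G.degree w).card ∧
      2 ≤ ((G.neighborFinset y).filter fun w => 4 ≤ G.degree w).card ∧
      (G.degree y = 5 → 3 ≤ ((G.neighborFinset y).filter fun w => 4 ≤ G.degree w).card)) := by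
  have F := hG.isObstruction hv hx hy hz hxy hxz hyz hdx
  obtain ⟨c, hc, s, t, hst, hs, ht, hl⟩ := exists_isColoringOf hG.2 hx hy hz hxy hxz hyz
  have hdy := degreeAvoiding_add_one hy
  have hdz := degreeAvoiding_add_one hz
  refine (F.largeNeighbors hc hs ht hst hl).imp ?_ ?_ <;> rintro ⟨h1, h2, h3⟩
  · exact ⟨h1.le_card hc hdx, h2.le_card hc hdx, fun h => (h3 (by omega)).le_card hc hdx⟩
  · exact ⟨h1.le_card hc hdx, h2.le_card hc hdx, fun h => (h3 (by omega)).le_card hc hdx⟩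
end

section
/- Let G be an acyclically edge (Δ(G)+2)-critical finite simple graph, let v be a vertex of degree 3 with a neighbor x of degree 4. Then there exists an acyclic edge (Δ(G)+2)-coloring φ of G − vx such that the set of colors on edges incident to v and the set of colors on edges incident to x share exactly one color. -/
open SimpleGraph

/-- `F_v(c)`: the set of colors appearing on edges of `G` incident to `v`. -/
def colorsAt {V : Type*} {α : Type*} (G : SimpleGraph V) (c : Sym2 V → α) (v : V) : Set α :=
  {a | ∃ u, G.Adj v u ∧ c s(v, u) = a}

section BichromaticSubgraph

variable {V α : Type*} {G H : SimpleGraph V} {c : Sym2 V → α} {a b j : α} {u w : V}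

/-- The subgraph of `G` formed by the edges colored `a` or `b`. -/
def bichromatic (G : SimpleGraph V) (c : Sym2 V → α) (a b : α) : SimpleGraph V where
  Adj p q := G.Adj p q ∧ (c s(p, q) = a ∨ c s(p, q) = b)
  symm := ⟨fun p q h => by rw [Sym2.eq_swap]; exact ⟨h.1.symm, h.2⟩⟩
  loopless := ⟨fun p h => G.loopless.irrefl p h.1⟩

/-- The subgraph of `G` formed by the edges avoiding the vertices `v` and `x`. -/
def avoiding (G : SimpleGraph V) (v x : V) : SimpleGraph V where
  Adj p q := G.Adj p q ∧ (p ≠ v ∧ p ≠ x) ∧ q ≠ v ∧ q ≠ x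
  symm := ⟨fun _ _ h => ⟨h.1.symm, h.2.2, h.2.1⟩⟩
  loopless := ⟨fun p h => G.loopless.irrefl p h.1⟩

lemma avoiding_le (v x : V) : avoiding G v x ≤ G := fun _ _ h => h.1

lemma mem_colorsAt (h : G.Adj u w) : c s(u, w) ∈ colorsAt G c u := ⟨w, h, rfl⟩

lemma mem_colorsAt' (h : G.Adj u w) : c s(u, w) ∈ colorsAt G c w :=
  ⟨u, h.symm, by rw [Sym2.eq_swap]⟩

lemma colorsAt_eq_image (G : SimpleGraph V) (c : Sym2 V → α) (u : V) :
    colorsAt G c u = (fun w => c s(u, w)) '' G.neighborSet u := rfl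

lemma IsProperEdgeColoring.eq_of_eq (hc : IsProperEdgeColoring G c) {p q : V}
    (hp : G.Adj u p) (hq : G.Adj u q) (h : c s(u, p) = c s(u, q)) : p = q := by
  by_contra hne
  exact hc _ hp _ hq (fun h => hne (Sym2.congr_right.1 h)) ⟨u, by simp, by simp⟩ h

lemma isProperEdgeColoring_of_forall
    (h : ∀ u p q, G.Adj u p → G.Adj u q → c s(u, p) = c s(u, q) → p = q) :
    IsProperEdgeColoring G c := by
  rintro e₁ h₁ e₂ h₂ hne ⟨u, ⟨p, rfl⟩, ⟨q, rfl⟩⟩ heq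
  exact hne (by rw [h u p q h₁ h₂ heq])

lemma IsProperEdgeColoring.mono (hc : IsProperEdgeColoring G c) (hle : H ≤ G) :
    IsProperEdgeColoring H c :=
  fun e₁ h₁ e₂ h₂ => hc e₁ (edgeSet_mono hle h₁) e₂ (edgeSet_mono hle h₂)

lemma IsAcyclicEdgeColoring.mono (hc : IsAcyclicEdgeColoring G c) (hle : H ≤ G) :
    IsAcyclicEdgeColoring H c := by
  refine ⟨hc.1.mono hle, fun v w hw ⟨a, b, hab⟩ => hc.2 v (w.mapLe hle) (hw.mapLe hle) ⟨a, b, ?_⟩⟩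
  simpa using hab

lemma IsProperEdgeColoring.ncard_colorsAt (hc : IsProperEdgeColoring G c) (u : V) :
    (colorsAt G c u).ncard = (G.neighborSet u).ncard := by
  rw [colorsAt_eq_image]
  exact Set.InjOn.ncard_image fun p hp q hq h => hc.eq_of_eq hp hq h

lemma mem_colorsAt_of_reachable (h : (bichromatic G c a j).Reachable u w) (hne : u ≠ w) :
    a ∈ colorsAt G c u ∨ j ∈ colorsAt G c u := by
  obtain ⟨p⟩ := h
  cases p with
  | nil => exact absurd rfl hne
  | cons h _ => exact h.2.imp (fun e => ⟨_, h.1, e⟩) (fun e => ⟨_, h.1, e⟩)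

lemma exists_mem_edges_of_isCycle {v : V} {p : G.Walk v v} (hp : p.IsCycle)
    (hu : u ∈ p.support) (t : V) : ∃ q, q ≠ t ∧ s(u, q) ∈ p.edges := by
  have h2 := hp.ncard_neighborSet_toSubgraph_eq_two hu
  obtain ⟨q, hq, hne⟩ := Set.exists_ne_of_one_lt_ncard (h2 ▸ one_lt_two) t
  exact ⟨q, hne, (Walk.adj_toSubgraph_iff_mem_edges).1 hq⟩

open Classical in
/-- An edge may be colored `j` when `j` is missing at both ends and no bichromatic path joins
them. -/
lemma IsAcyclicEdgeColoring.update (he : G.Adj u w)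
    (hc : IsAcyclicEdgeColoring (G.deleteEdges {s(u, w)}) c)
    (hu : j ∉ colorsAt (G.deleteEdges {s(u, w)}) c u)
    (hw : j ∉ colorsAt (G.deleteEdges {s(u, w)}) c w)
    (hr : ∀ a ∈ colorsAt (G.deleteEdges {s(u, w)}) c u,
      a ∈ colorsAt (G.deleteEdges {s(u, w)}) c w →
      ¬ (bichromatic (G.deleteEdges {s(u, w)}) c a j).Reachable u w) :
    IsAcyclicEdgeColoring G (Function.update c s(u, w) j) := by
  set K := G.deleteEdges {s(u, w)} with hK
  have hKadj : ∀ {p q}, G.Adj p q → s(p, q) ≠ s(u, w) → K.Adj p q := fun h h' => by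
    rw [hK, deleteEdges_adj]; exact ⟨h, h'⟩
  have hmiss : ∀ t p, s(t, p) = s(u, w) → j ∉ colorsAt K c t := by
    intro t p h
    rcases Sym2.eq_iff.1 h with ⟨rfl, rfl⟩ | ⟨rfl, rfl⟩ <;> assumption
  have hnr : ∀ a, ¬ (bichromatic K c a j).Reachable u w := fun a h =>
    hr a ((mem_colorsAt_of_reachable h he.ne).resolve_right hu)
      ((mem_colorsAt_of_reachable h.symm he.ne').resolve_right hw) h
  refine ⟨isProperEdgeColoring_of_forall fun t p q hp hq h => ?_, ?_⟩
  · by_cases h1 : s(t, p) = s(u, w) <;> by_cases h2 : s(t, q) = s(u, w)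
    · exact Sym2.congr_right.1 (h1.trans h2.symm)
    · rw [h1, Function.update_self, Function.update_of_ne h2] at h
      exact absurd (h ▸ mem_colorsAt (hKadj hq h2)) (hmiss t p h1)
    · rw [h2, Function.update_self, Function.update_of_ne h1] at h
      exact absurd (h ▸ mem_colorsAt (hKadj hp h1)) (hmiss t q h2)
    · rw [Function.update_of_ne h1, Function.update_of_ne h2] at h
      exact hc.1.eq_of_eq (hKadj hp h1) (hKadj hq h2) h
  · rintro t p hp ⟨a, b, hab⟩
    by_cases hmem : s(u, w) ∈ p.edges
    · have hM : ∀ e ∈ p.edges, e ∈ (bichromatic G (Function.update c s(u, w) j) a b).edgeSet := by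
        intro e hep
        induction e with | _ r s => exact ⟨p.adj_of_mem_edges hep, hab _ hep⟩
      have hreach := (adj_and_reachable_delete_edges_iff_exists_cycle.2
        ⟨t, p.transfer _ hM, hp.transfer hM, by simpa using hmem⟩).2
      have hle : ∀ d, (∀ f, f = a ∨ f = b → f = d ∨ f = j) →
          bichromatic G (Function.update c s(u, w) j) a b \ fromEdgeSet {s(u, w)}
            ≤ bichromatic K c d j := by
        rintro d hd r s ⟨⟨h1, h2⟩, h3⟩
        have hne : s(r, s) ≠ s(u, w) := fun h => h3 (by
          rw [fromEdgeSet_adj]; exact ⟨h, h1.ne⟩)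
        rw [Function.update_of_ne hne] at h2
        exact ⟨hKadj h1 hne, hd _ h2⟩
      have hj := hab _ hmem
      rw [Function.update_self] at hj
      rcases hj with rfl | rfl
      · exact hnr b (hreach.mono (hle b fun f hf => hf.symm))
      · exact hnr a (hreach.mono (hle a fun f hf => hf))
    · have hM : ∀ e ∈ p.edges, e ∈ K.edgeSet := by
        intro e hep
        induction e with
        | _ r s => exact hKadj (p.adj_of_mem_edges hep) (fun h => hmem (h ▸ hep))
      refine hc.2 t (p.transfer _ hM) (hp.transfer hM) ⟨a, b, fun e hep => ?_⟩
      rw [Walk.edges_transfer] at hep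
      have hne : e ≠ s(u, w) := fun h => hmem (h ▸ hep)
      simpa only [Function.update_of_ne hne] using hab e hep

open Classical in
/-- The coloring obtained by permuting the colors of the edges at `u`. -/
noncomputable def recolorAt (c : Sym2 V → α) (u : V) (σ : Equiv.Perm α) : Sym2 V → α :=
  fun e => if u ∈ e then σ (c e) else c e

lemma recolorAt_of_mem {σ : Equiv.Perm α} {e : Sym2 V} (h : u ∈ e) :
    recolorAt c u σ e = σ (c e) := if_pos h

lemma recolorAt_of_notMem {σ : Equiv.Perm α} {e : Sym2 V} (h : u ∉ e) :
    recolorAt c u σ e = c e := if_neg h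

/-- If the colors at `u` belong to a set `S` which occurs nowhere else at the neighbors of `u`,
they may be permuted within `S`. -/
lemma IsAcyclicEdgeColoring.recolorAt (hc : IsAcyclicEdgeColoring G c) {S : Set α}
    {σ : Equiv.Perm α} (hσ : ∀ s ∈ S, σ s ∈ S) (hS : ∀ p, G.Adj u p → c s(u, p) ∈ S)
    (hS' : ∀ p, G.Adj u p → ∀ q, q ≠ u → G.Adj p q → c s(p, q) ∉ S) :
    IsAcyclicEdgeColoring G (recolorAt c u σ) := by
  have key : ∀ t p q, G.Adj t p → G.Adj t q → u ∈ s(t, p) → u ∉ s(t, q) →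
      _root_.recolorAt c u σ s(t, p) ≠ _root_.recolorAt c u σ s(t, q) := by
    intro t p q hp hq h1 h2 h
    rw [recolorAt_of_mem h1, recolorAt_of_notMem h2] at h
    simp only [Sym2.mem_iff, not_or] at h1 h2
    obtain rfl : u = p := h1.resolve_left h2.1
    refine hS' t hp.symm q (Ne.symm h2.2) hq ?_
    rw [← h, Sym2.eq_swap]
    exact hσ _ (hS t hp.symm)
  refine ⟨isProperEdgeColoring_of_forall fun t p q hp hq h => ?_, ?_⟩
  · by_cases h1 : u ∈ s(t, p) <;> by_cases h2 : u ∈ s(t, q)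
    · rw [recolorAt_of_mem h1, recolorAt_of_mem h2] at h
      exact hc.1.eq_of_eq hp hq (σ.injective h)
    · exact absurd h (key t p q hp hq h1 h2)
    · exact absurd h.symm (key t q p hq hp h2 h1)
    · rw [recolorAt_of_notMem h1, recolorAt_of_notMem h2] at h
      exact hc.1.eq_of_eq hp hq h
  · rintro t w hw ⟨a, b, hab⟩
    by_cases hu : u ∈ w.support
    · obtain ⟨p, -, hp⟩ := exists_mem_edges_of_isCycle hw hu u
      obtain ⟨q, hqp, hq⟩ := exists_mem_edges_of_isCycle hw hu p
      have hpG := w.adj_of_mem_edges hp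
      have hqG := w.adj_of_mem_edges hq
      obtain ⟨r, hru, hr⟩ := exists_mem_edges_of_isCycle hw (w.snd_mem_support_of_mem_edges hp) u
      have hrG := w.adj_of_mem_edges hr
      have hap := hab _ hp
      have haq := hab _ hq
      have har := hab _ hr
      rw [recolorAt_of_mem (by simp)] at hap haq
      rw [recolorAt_of_notMem (by simp [hru.symm, hpG.ne])] at har
      have hne : σ (c s(u, p)) ≠ σ (c s(u, q)) := fun h =>
        hqp (hc.1.eq_of_eq hpG hqG (σ.injective h)).symm
      have hpS := hσ _ (hS p hpG)
      have hqS := hσ _ (hS q hqG)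
      have hrS := hS' p hpG r hru hrG
      grind
    · refine hc.2 t w hw ⟨a, b, fun e he => ?_⟩
      have := hab e he
      rwa [recolorAt_of_notMem (fun h => hu (Walk.mem_support_of_mem_edges he h))] at this

/-- A connected graph of maximum degree at most two has at most two vertices of degree at most
one. -/
lemma SimpleGraph.Connected.not_three_ends [Finite V] (hG : G.Connected)
    (h2 : ∀ t, (G.neighborSet t).ncard ≤ 2) {p q r : V} (hpq : p ≠ q) (hpr : p ≠ r) (hqr : q ≠ r)
    (hp : (G.neighborSet p).ncard ≤ 1) (hq : (G.neighborSet q).ncard ≤ 1)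
    (hr : (G.neighborSet r).ncard ≤ 1) : False := by
  classical
  have := Fintype.ofFinite V
  have hdeg : ∀ t, (G.neighborSet t).ncard = G.degree t := fun t => by
    rw [← Nat.card_coe_set_eq, Nat.card_eq_fintype_card, card_neighborSet_eq_degree]
  simp only [hdeg] at *
  have hcard := hG.card_vert_le_card_edgeSet_add_one
  rw [Nat.card_eq_fintype_card, Nat.card_eq_fintype_card, ← edgeFinset_card] at hcard
  have hsum := G.sum_degrees_eq_twice_card_edges
  have h3 : ∑ t ∈ ({p, q, r} : Finset V), G.degree t ≤ 3 := by
    rw [Finset.sum_insert (by simp [hpq, hpr]), Finset.sum_pair hqr]; omega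
  have hrest : ∑ t ∈ ({p, q, r} : Finset V)ᶜ, G.degree t ≤ ({p, q, r} : Finset V)ᶜ.card * 2 :=
    Finset.sum_le_card_nsmul _ _ _ fun t _ => h2 t
  have hc3 : ({p, q, r} : Finset V).card = 3 := Finset.card_eq_three.2 ⟨p, q, r, hpq, hpr, hqr, rfl⟩
  have := Finset.card_add_card_compl ({p, q, r} : Finset V)
  have := Finset.sum_add_sum_compl ({p, q, r} : Finset V) (fun t => G.degree t)
  omega

lemma SimpleGraph.not_three_ends [Finite V]
    (h2 : ∀ t, (G.neighborSet t).ncard ≤ 2) {p q r : V} (hpq : p ≠ q) (hpr : p ≠ r) (hqr : q ≠ r)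
    (hp : (G.neighborSet p).ncard ≤ 1) (hq : (G.neighborSet q).ncard ≤ 1)
    (hr : (G.neighborSet r).ncard ≤ 1) (rpq : G.Reachable p q) (rpr : G.Reachable p r) :
    False := by
  set C := G.connectedComponentMk p with hC
  have hle : ∀ t : C.supp, (C.toSimpleGraph.neighborSet t).ncard ≤ (G.neighborSet t.1).ncard := by
    intro t
    rw [← Set.ncard_image_of_injective _ Subtype.val_injective]
    refine Set.ncard_le_ncard ?_ (Set.toFinite _)
    rintro _ ⟨s, hs, rfl⟩
    exact hs
  refine C.connected_toSimpleGraph.not_three_ends (p := ⟨p, rfl⟩)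
    (q := ⟨q, ConnectedComponent.sound rpq.symm⟩) (r := ⟨r, ConnectedComponent.sound rpr.symm⟩)
    (fun t => (hle t).trans (h2 _))
    (fun h => hpq (congrArg Subtype.val h)) (fun h => hpr (congrArg Subtype.val h))
    (fun h => hqr (congrArg Subtype.val h))
    ((hle _).trans hp) ((hle _).trans hq) ((hle _).trans hr)

lemma IsProperEdgeColoring.not_reachable_three [Finite V] (hc : IsProperEdgeColoring G c)
    {p q r : V} (hpq : p ≠ q) (hpr : p ≠ r) (hqr : q ≠ r)
    (hp : a ∉ colorsAt G c p ∨ j ∉ colorsAt G c p) (hq : a ∉ colorsAt G c q ∨ j ∉ colorsAt G c q)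
    (hr : a ∉ colorsAt G c r ∨ j ∉ colorsAt G c r) (rpq : (bichromatic G c a j).Reachable p q)
    (rpr : (bichromatic G c a j).Reachable p r) : False := by
  have hN : ∀ t (S : Set α), (∀ s, (bichromatic G c a j).Adj t s → c s(t, s) ∈ S) → S.Finite →
      ((bichromatic G c a j).neighborSet t).ncard ≤ S.ncard := fun t S h hS =>
    Set.ncard_le_ncard_of_injOn (fun s => c s(t, s)) h
      (fun p hp q hq h => hc.eq_of_eq hp.1 hq.1 h) hS
  have h1 : ∀ t, (a ∉ colorsAt G c t ∨ j ∉ colorsAt G c t) →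
      ((bichromatic G c a j).neighborSet t).ncard ≤ 1 := by
    rintro t (h | h)
    · rw [← Set.ncard_singleton j]
      exact hN t _ (fun s hs => hs.2.resolve_left fun e => h ⟨s, hs.1, e⟩) (Set.toFinite _)
    · rw [← Set.ncard_singleton a]
      exact hN t _ (fun s hs => hs.2.resolve_right fun e => h ⟨s, hs.1, e⟩) (Set.toFinite _)
  refine SimpleGraph.not_three_ends (fun t => ?_) hpq hpr hqr (h1 p hp) (h1 q hq) (h1 r hr) rpq rpr
  exact (hN t {a, j} (fun s hs => hs.2) (Set.toFinite _)).trans (by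
    simpa using Set.ncard_insert_le a {j})

/-- When both `v` and `x` miss `j`, a bichromatic path from `v` to `x` runs, between its end
edges, outside `v` and `x`. -/
lemma exists_reachable_avoiding {v x y : V} (hvx : ¬ G.Adj v x) (hne : v ≠ x)
    (hc : IsProperEdgeColoring G c) (hy : G.Adj v y) (hj : j ∉ colorsAt G c v)
    (hjx : j ∉ colorsAt G c x) (h : (bichromatic G c (c s(v, y)) j).Reachable v x) :
    ∃ p, G.Adj x p ∧ c s(x, p) = c s(v, y) ∧
      (bichromatic (avoiding G v x) c (c s(v, y)) j).Reachable p y := by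
  obtain ⟨w, hw⟩ := h.exists_isPath
  cases w with
  | nil => exact absurd rfl hne
  | @cons _ s _ h₁ w₁ =>
    rw [Walk.cons_isPath_iff] at hw
    obtain rfl : s = y := hc.eq_of_eq h₁.1 hy (h₁.2.resolve_right fun e => hj ⟨s, h₁.1, e⟩)
    obtain ⟨w₂, hw₂, hv₂⟩ : ∃ w₂ : (bichromatic G c (c s(v, s)) j).Walk x s,
        w₂.IsPath ∧ v ∉ w₂.support := ⟨w₁.reverse, hw.1.reverse, by simpa using hw.2⟩
    cases w₂ with
    | nil => exact absurd hy hvx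
    | @cons _ t _ h₂ w₃ =>
      rw [Walk.cons_isPath_iff] at hw₂
      refine ⟨t, h₂.1, h₂.2.resolve_right fun e => hjx ⟨t, h₂.1, e⟩, ⟨w₃.transfer _ ?_⟩⟩
      intro e he
      induction e with
      | _ p q =>
        have hpq := w₃.adj_of_mem_edges he
        have hp := w₃.fst_mem_support_of_mem_edges he
        have hq := w₃.snd_mem_support_of_mem_edges he
        rw [Walk.support_cons, List.mem_cons, not_or] at hv₂
        exact ⟨⟨hpq.1, ⟨fun e => hv₂.2 (e ▸ hp), fun e => hw₂.2 (e ▸ hp)⟩,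
          fun e => hv₂.2 (e ▸ hq), fun e => hw₂.2 (e ▸ hq)⟩, hpq.2⟩

lemma bichromatic_avoiding_recolorAt {v x : V} (hu : u = v ∨ u = x) (σ : Equiv.Perm α) :
    bichromatic (avoiding G v x) (recolorAt c u σ) a b = bichromatic (avoiding G v x) c a b := by
  ext p q
  refine and_congr_right fun h => ?_
  have hnot : u ∉ s(p, q) := by
    have := h.2
    rw [Sym2.mem_iff]
    rcases hu with rfl | rfl <;> tauto
  rw [recolorAt_of_notMem hnot]

lemma notMem_colorsAt_avoiding {v x t : V} {S : Set α} (hu : u = v ∨ u = x)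
    (h : ∀ q, q ≠ u → G.Adj t q → c s(t, q) ∉ S) (ha : a ∈ S) :
    a ∉ colorsAt (avoiding G v x) c t := by
  rintro ⟨q, hq, rfl⟩
  refine h q ?_ hq.1 ha
  rcases hu with rfl | rfl
  exacts [hq.2.2.1, hq.2.2.2]

lemma swap_apply_mem [DecidableEq α] {S : Set α} (ha : a ∈ S) (hb : b ∈ S) :
    ∀ s ∈ S, Equiv.swap a b s ∈ S := by
  intro s hs
  rw [Equiv.swap_apply_def]
  split_ifs <;> assumption

/-- Two distinct elements of `S` are moved to any other two by a permutation preserving `S`. -/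
lemma exists_perm_pair {S : Set α} {p q : α} (hp : p ∈ S) (hq : q ∈ S) (hpq : p ≠ q)
    (ha : a ∈ S) (hb : b ∈ S) (hab : a ≠ b) :
    ∃ σ : Equiv.Perm α, (∀ s ∈ S, σ s ∈ S) ∧ σ p = a ∧ σ q = b := by
  classical
  have hne : a ≠ Equiv.swap p a q := fun h => hpq ((Equiv.swap p a).injective (by simpa using h))
  refine ⟨(Equiv.swap p a).trans (Equiv.swap (Equiv.swap p a q) b), fun s hs => ?_, ?_, ?_⟩
  · exact swap_apply_mem (swap_apply_mem hp ha q hq) hb _ (swap_apply_mem hp ha s hs)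
  · simp [Equiv.swap_apply_of_ne_of_ne hne hab]
  · simp

lemma IsProperEdgeColoring.notMem_of_forall_mem_colorsAt [Finite V] {D : ℕ}
    {c : Sym2 V → Fin (D + 2)} (hc : IsProperEdgeColoring G c)
    (hD : (G.neighborSet u).ncard ≤ D) {S : Set (Fin (D + 2))} (hS : S.ncard = 3) (h : ∀ j ∉ S, j ∈ colorsAt G c u) (hw : G.Adj u w) (hwS : c s(u, w) ∈ S) :
    ∀ q, q ≠ w → G.Adj u q → c s(u, q) ∉ S := by
  intro q hqw hq hqS
  have hne : c s(u, w) ≠ c s(u, q) := fun e => hqw (hc.eq_of_eq hw hq e).symm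
  have hsub : insert (c s(u, w)) (insert (c s(u, q)) Sᶜ) ⊆ colorsAt G c u := by
    rintro a (rfl | rfl | ha)
    exacts [mem_colorsAt hw, mem_colorsAt hq, h a ha]
  have hle := Set.ncard_le_ncard hsub (Set.toFinite _)
  rw [hc.ncard_colorsAt, Set.ncard_insert_of_notMem (by simp [hne, hwS]) (Set.toFinite _),
    Set.ncard_insert_of_notMem (by simpa using hqS) (Set.toFinite _)] at hle
  have := Set.ncard_add_ncard_compl S
  rw [Nat.card_eq_fintype_card, Fintype.card_fin] at this
  omega

end BichromaticSubgraph

section Obstruction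

variable {V : Type*} {H : SimpleGraph V} {D : ℕ} {v x y z : V} {c : Sym2 V → Fin (D + 2)}
  {a b j s : Fin (D + 2)}

/-- The situation in which `v` has neighbors `y`, `z`, the vertex `x` has degree three, and no
acyclic edge coloring of `H` extends to the edge `vx` or has exactly one color common to `v` and
`x`. -/
structure Obstructed (H : SimpleGraph V) (D : ℕ) (v x y z : V) : Prop where
  ne : v ≠ x
  not_adj : ¬ H.Adj v x
  ne' : y ≠ z
  adj_iff : ∀ w, H.Adj v w ↔ w = y ∨ w = z
  degree_le : ∀ u, (H.neighborSet u).ncard ≤ D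
  degree_eq : (H.neighborSet x).ncard = 3
  two_le : 2 ≤ D
  common : ∀ c : Sym2 V → Fin (D + 2), IsAcyclicEdgeColoring H c →
    c s(v, y) ∈ colorsAt H c x ∧ c s(v, z) ∈ colorsAt H c x
  reachable : ∀ c : Sym2 V → Fin (D + 2), IsAcyclicEdgeColoring H c → ∀ j ∉ colorsAt H c x,
    (bichromatic H c (c s(v, y)) j).Reachable v x ∨ (bichromatic H c (c s(v, z)) j).Reachable v x

/-- The `(s, j)`-colored path starting at `x` with color `s` reaches `t` without meeting `v`. -/
def KempeJoined (H : SimpleGraph V) (c : Sym2 V → Fin (D + 2)) (v x t : V)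
    (s j : Fin (D + 2)) : Prop :=
  ∃ p, H.Adj x p ∧ c s(x, p) = s ∧ (bichromatic (avoiding H v x) c s j).Reachable p t

namespace Obstructed

lemma symm (h : Obstructed H D v x y z) : Obstructed H D v x z y where
  ne := h.ne
  not_adj := h.not_adj
  ne' := h.ne'.symm
  adj_iff w := (h.adj_iff w).trans or_comm
  degree_le := h.degree_le
  degree_eq := h.degree_eq
  two_le := h.two_le
  common c hc := (h.common c hc).symm
  reachable c hc j hj := (h.reachable c hc j hj).symm

lemma adj_left (h : Obstructed H D v x y z) : H.Adj v y := (h.adj_iff y).2 (Or.inl rfl)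

lemma adj_right (h : Obstructed H D v x y z) : H.Adj v z := (h.adj_iff z).2 (Or.inr rfl)

lemma color_ne (h : Obstructed H D v x y z) (hc : IsAcyclicEdgeColoring H c) :
    c s(v, y) ≠ c s(v, z) := fun e => h.ne' (hc.1.eq_of_eq h.adj_left h.adj_right e)

lemma ncard_colorsAt (h : Obstructed H D v x y z) (hc : IsAcyclicEdgeColoring H c) :
    (colorsAt H c x).ncard = 3 := by rw [hc.1.ncard_colorsAt, h.degree_eq]

lemma colorsAt_subset (h : Obstructed H D v x y z) (hc : IsAcyclicEdgeColoring H c) :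
    colorsAt H c v ⊆ colorsAt H c x := by
  rintro _ ⟨w, hw, rfl⟩
  rcases (h.adj_iff w).1 hw with rfl | rfl
  exacts [(h.common c hc).1, (h.common c hc).2]

variable [Finite V]

lemma mem_colorsAt_right (h : Obstructed H D v x y z) (hc : IsAcyclicEdgeColoring H c)
    (hj : j ∉ colorsAt H c x) : j ∈ colorsAt H c z := by
  classical
  by_contra hjz
  have hzx : z ≠ x := fun e => h.not_adj (e ▸ h.adj_right)
  have hjv : j ∉ colorsAt H c v := fun hv => hj (h.colorsAt_subset hc hv)
  set K := H.deleteEdges {s(v, z)} with hK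
  have hKle : K ≤ H := deleteEdges_le _
  have hcol : ∀ t, colorsAt K c t ⊆ colorsAt H c t := fun t => by
    rintro _ ⟨w, hw, rfl⟩
    exact ⟨w, hKle hw, rfl⟩
  have hnot : ¬ IsAcyclicEdgeColoring H (Function.update c s(v, z) j) := fun hc' => by
    obtain ⟨w, hw, he⟩ := (h.common _ hc').2
    rw [Function.update_self, Function.update_of_ne (by simp [h.ne.symm, hzx.symm])] at he
    exact hj ⟨w, hw, he⟩
  refine hnot ((hc.mono hKle).update h.adj_right (fun e => hjv (hcol _ e))
    (fun e => hjz (hcol _ e)) ?_)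
  rintro a ⟨w, hw, rfl⟩ - hr
  rw [deleteEdges_adj] at hw
  have hwy : w = y := ((h.adj_iff w).1 hw.1).resolve_right fun e => hw.2 (by simp [e])
  subst hwy
  have hr' : (bichromatic H c (c s(v, w)) j).Reachable v z :=
    hr.mono (fun _ _ hpq => ⟨hKle hpq.1, hpq.2⟩ :
      bichromatic K c (c s(v, w)) j ≤ bichromatic H c (c s(v, w)) j)
  have hz : (bichromatic H c (c s(v, z)) j).Reachable v z :=
    Adj.reachable ⟨h.adj_right, Or.inl rfl⟩
  rcases h.reachable c hc j hj with hx | hx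
  · exact hc.1.not_reachable_three h.ne h.adj_right.ne hzx.symm (.inr hjv) (.inr hj) (.inr hjz)
      hx hr'
  · exact hc.1.not_reachable_three h.ne h.adj_right.ne hzx.symm (.inr hjv) (.inr hj) (.inr hjz)
      hx hz

lemma notMem_right (h : Obstructed H D v x y z) (hc : IsAcyclicEdgeColoring H c) :
    ∀ q, q ≠ v → H.Adj z q → c s(z, q) ∉ colorsAt H c x :=
  hc.1.notMem_of_forall_mem_colorsAt (h.degree_le z) (h.ncard_colorsAt hc)
    (fun _ hj => h.mem_colorsAt_right hc hj) h.adj_right.symm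
    (by rw [Sym2.eq_swap]; exact (h.common c hc).2)

lemma not_adj_right (h : Obstructed H D v x y z) (hc : IsAcyclicEdgeColoring H c) :
    ¬ H.Adj x z := fun hxz =>
  h.notMem_right hc x h.ne.symm hxz.symm (mem_colorsAt' hxz.symm)

lemma joined_or (h : Obstructed H D v x y z) (hc : IsAcyclicEdgeColoring H c)
    (hj : j ∉ colorsAt H c x) (ha : a ∈ colorsAt H c x) (hb : b ∈ colorsAt H c x) (hab : a ≠ b) :
    KempeJoined H c v x y a j ∨ KempeJoined H c v x z b j := by
  obtain ⟨σ, hσ, hσa, hσb⟩ := exists_perm_pair (h.common c hc).1 (h.common c hc).2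
    (h.color_ne hc) ha hb hab
  have hc' : IsAcyclicEdgeColoring H (recolorAt c v σ) := by
    refine hc.recolorAt hσ (fun p hp => h.colorsAt_subset hc ⟨p, hp, rfl⟩) fun p hp => ?_
    rcases (h.adj_iff p).1 hp with rfl | rfl
    exacts [h.symm.notMem_right hc, h.notMem_right hc]
  have hx : ∀ p, H.Adj x p → recolorAt c v σ s(x, p) = c s(x, p) := fun p hp => by
    refine recolorAt_of_notMem ?_
    rw [Sym2.mem_iff, not_or]
    exact ⟨h.ne, fun e => h.not_adj (e ▸ hp.symm)⟩
  have hjx : j ∉ colorsAt H (recolorAt c v σ) x := by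
    rintro ⟨p, hp, e⟩
    exact hj ⟨p, hp, (hx p hp).symm.trans e⟩
  have hjv : j ∉ colorsAt H (recolorAt c v σ) v := fun e => hjx (h.colorsAt_subset hc' e)
  have key : ∀ t d, H.Adj v t → σ (c s(v, t)) = d →
      (bichromatic H (recolorAt c v σ) (recolorAt c v σ s(v, t)) j).Reachable v x →
      KempeJoined H c v x t d j := by
    rintro t d ht rfl hr
    obtain ⟨p, hp, he, hreach⟩ := exists_reachable_avoiding h.not_adj h.ne hc'.1 ht hjv hjx hr
    rw [hx p hp, recolorAt_of_mem (by simp)] at he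
    rw [bichromatic_avoiding_recolorAt (.inl rfl), recolorAt_of_mem (by simp)] at hreach
    exact ⟨p, hp, he, hreach⟩
  exact (h.reachable _ hc' j hjx).imp (key y a h.adj_left hσa) (key z b h.adj_right hσb)

lemma not_joined_both (h : Obstructed H D v x y z) (hc : IsAcyclicEdgeColoring H c)
    (hs : s ∈ colorsAt H c x) (h₁ : KempeJoined H c v x y s j) (h₂ : KempeJoined H c v x z s j) :
    False := by
  obtain ⟨p, hp, hps, hpy⟩ := h₁
  obtain ⟨q, hq, hqs, hqz⟩ := h₂
  obtain rfl : p = q := hc.1.eq_of_eq hp hq (hps.trans hqs.symm)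
  refine (hc.1.mono (avoiding_le v x)).not_reachable_three
    (fun e : p = y => h.symm.not_adj_right hc (e ▸ hp))
    (fun e : p = z => h.not_adj_right hc (e ▸ hp)) h.ne'
    (.inl ?_) (.inl (notMem_colorsAt_avoiding (.inl rfl) (h.symm.notMem_right hc) hs))
    (.inl (notMem_colorsAt_avoiding (.inl rfl) (h.notMem_right hc) hs)) hpy hqz
  rintro ⟨t, ht, he⟩
  refine ht.2.2.2 (hc.1.eq_of_eq ht.1 hp.symm ?_)
  rw [he, ← hps, Sym2.eq_swap]

lemma joined_all (h : Obstructed H D v x y z) (hc : IsAcyclicEdgeColoring H c)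
    (hj : j ∉ colorsAt H c x) :
    (∀ s ∈ colorsAt H c x, KempeJoined H c v x y s j) ∨
      ∀ s ∈ colorsAt H c x, KempeJoined H c v x z s j := by
  by_cases hex : ∃ a ∈ colorsAt H c x, KempeJoined H c v x y a j
  · obtain ⟨a, ha, haj⟩ := hex
    refine .inl fun s hs => ?_
    by_cases hsa : s = a
    · exact hsa ▸ haj
    · exact (h.joined_or hc hj hs ha hsa).resolve_right fun e => h.not_joined_both hc ha haj e
  · refine .inr fun s hs => ?_
    obtain ⟨b, hb, hbs⟩ := Set.exists_ne_of_one_lt_ncard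
      (by rw [h.ncard_colorsAt hc]; norm_num : 1 < (colorsAt H c x).ncard) s
    exact (h.joined_or hc hj hb hs hbs).resolve_left fun e => hex ⟨b, hb, e⟩

lemma notMem_of_adj (h : Obstructed H D v x y z) (hc : IsAcyclicEdgeColoring H c) {p : V}
    (hp : H.Adj x p) : ∀ q, q ≠ x → H.Adj p q → c s(p, q) ∉ colorsAt H c x := by
  refine hc.1.notMem_of_forall_mem_colorsAt (h.degree_le p) (h.ncard_colorsAt hc)
    (fun j hj => ?_) hp.symm (mem_colorsAt' hp.symm)
  have key : ∀ t, ¬ H.Adj x t → KempeJoined H c v x t (c s(x, p)) j → j ∈ colorsAt H c p := by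
    rintro t ht ⟨q, hq, he, hr⟩
    obtain rfl : q = p := hc.1.eq_of_eq hq hp he
    rcases mem_colorsAt_of_reachable hr (fun e => ht (e ▸ hp)) with ⟨r, hr, he⟩ | ⟨r, hr, he⟩
    · exact absurd (hc.1.eq_of_eq hr.1 hp.symm (by rw [he, Sym2.eq_swap])) hr.2.2.2
    · exact ⟨r, hr.1, he⟩
  rcases h.joined_all hc hj with hall | hall
  · exact key y (h.symm.not_adj_right hc) (hall _ (mem_colorsAt hp))
  · exact key z (h.not_adj_right hc) (hall _ (mem_colorsAt hp))

lemma not_all_joined (h : Obstructed H D v x y z) (hc : IsAcyclicEdgeColoring H c)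
    (hj : j ∉ colorsAt H c x) (hall : ∀ s ∈ colorsAt H c x, KempeJoined H c v x y s j) :
    False := by
  classical
  obtain ⟨a, b, d, hab, had, hbd, hS⟩ := Set.ncard_eq_three.1 (h.ncard_colorsAt hc)
  have ha : a ∈ colorsAt H c x := by simp [hS]
  have hb : b ∈ colorsAt H c x := by simp [hS]
  have hd : d ∈ colorsAt H c x := by simp [hS]
  set σ := Equiv.swap a b with hσ
  have hσS : ∀ s ∈ colorsAt H c x, σ s ∈ colorsAt H c x := swap_apply_mem ha hb
  have hc' : IsAcyclicEdgeColoring H (recolorAt c x σ) :=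
    hc.recolorAt hσS (fun p hp => ⟨p, hp, rfl⟩) fun p hp => h.notMem_of_adj hc hp
  have hmem : ∀ s, s ∈ colorsAt H (recolorAt c x σ) x ↔ σ s ∈ colorsAt H c x := fun s => by
    refine exists_congr fun p => and_congr_right fun hp => ?_
    rw [recolorAt_of_mem (by simp), hσ, Equiv.swap_apply_eq_iff]
  have hjoin : ∀ t s, KempeJoined H (recolorAt c x σ) v x t s j →
      ∃ p, H.Adj x p ∧ c s(x, p) = σ s ∧
        (bichromatic (avoiding H v x) c s j).Reachable p t := by
    rintro t s ⟨p, hp, he, hr⟩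
    rw [recolorAt_of_mem (by simp), hσ, Equiv.swap_apply_eq_iff] at he
    rw [bichromatic_avoiding_recolorAt (.inr rfl)] at hr
    exact ⟨p, hp, he, hr⟩
  have hj' : j ∉ colorsAt H (recolorAt c x σ) x := fun e => hj (by
    simpa [hσ] using hσS _ ((hmem j).1 e))
  rcases h.joined_all hc' hj' with hall' | hall'
  · obtain ⟨p, hp, hpb, hpy⟩ := hjoin y a (hall' a ((hmem a).2 (hσS a ha)))
    obtain ⟨q, hq, hqa, hqy⟩ := hall a ha
    rw [hσ, Equiv.swap_apply_left] at hpb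
    have hny : ∀ t, H.Adj x t → y ≠ t := fun t ht e => h.symm.not_adj_right hc (e ▸ ht)
    refine (hc.1.mono (avoiding_le v x)).not_reachable_three (hny p hp) (hny q hq)
      (fun e => hab (by rw [← hqa, ← hpb, e]))
      (.inl (notMem_colorsAt_avoiding (.inl rfl) (h.symm.notMem_right hc) ha))
      (.inl (notMem_colorsAt_avoiding (.inr rfl) (h.notMem_of_adj hc hp) ha))
      (.inl (notMem_colorsAt_avoiding (.inr rfl) (h.notMem_of_adj hc hq) ha)) hpy.symm hqy.symm
  · obtain ⟨p, hp, hpd, hpz⟩ := hjoin z d (hall' d ((hmem d).2 (hσS d hd)))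
    rw [hσ, Equiv.swap_apply_of_ne_of_ne had.symm hbd.symm] at hpd
    exact h.not_joined_both hc hd (hall d hd) ⟨p, hp, hpd, hpz⟩

lemma not_isAcyclicEdgeColoring (h : Obstructed H D v x y z) : ¬ IsAcyclicEdgeColoring H c := by
  intro hc
  obtain ⟨j, hj⟩ : ∃ j, j ∉ colorsAt H c x := by
    by_contra! hall
    have h3 := h.ncard_colorsAt hc
    rw [Set.eq_univ_of_forall hall, Set.ncard_univ, Nat.card_eq_fintype_card,
      Fintype.card_fin] at h3
    have := h.two_le
    omega
  rcases h.joined_all hc hj with hall | hall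
  · exact h.not_all_joined hc hj hall
  · exact h.symm.not_all_joined hc hj hall

end Obstructed

end Obstruction

theorem stmt13 {V : Type*} [Fintype V] (G : SimpleGraph V) [DecidableRel G.Adj]
    (hG : IsAcyclicallyEdgeCritical G (G.maxDegree + 2))
    (v x : V) (hvx : G.Adj v x) (hv : G.degree v = 3) (hx : G.degree x = 4) :
    ∃ c : Sym2 V → Fin (G.maxDegree + 2),
      IsAcyclicEdgeColoring (G.deleteEdges {s(v, x)}) c ∧
      (colorsAt (G.deleteEdges {s(v, x)}) c v ∩
        colorsAt (G.deleteEdges {s(v, x)}) c x).ncard = 1 := by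
  classical
  by_contra! hN
  set K := G.deleteEdges {s(v, x)} with hK
  have hlt : K < G := by
    refine lt_of_le_of_ne (deleteEdges_le _) fun e => ?_
    rw [← e, hK, deleteEdges_adj] at hvx
    exact hvx.2 rfl
  obtain ⟨y, z, hyz, hnv⟩ : ∃ y z, y ≠ z ∧ (G.neighborFinset v).erase x = {y, z} := by
    rw [← Finset.card_eq_two, Finset.card_erase_of_mem (by simpa using hvx),
      card_neighborFinset_eq_degree, hv]
  have hadj : ∀ w, K.Adj v w ↔ w = y ∨ w = z := fun w => by
    have := congrArg (w ∈ ·) hnv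
    simp only [Finset.mem_erase, mem_neighborFinset, Finset.mem_insert, Finset.mem_singleton,
      eq_iff_iff] at this
    rw [← this, hK, deleteEdges_adj, Set.mem_singleton_iff, Sym2.congr_right, and_comm]
  have hdeg : ∀ u, (G.neighborSet u).ncard = G.degree u := fun u => by
    rw [← Nat.card_coe_set_eq, Nat.card_eq_fintype_card, card_neighborSet_eq_degree]
  have hdegK : ∀ u, (K.neighborSet u).ncard ≤ G.maxDegree := fun u =>
    (Set.ncard_le_ncard (fun w hw => hlt.le hw) (Set.toFinite _)).trans
      ((hdeg u).trans_le (G.degree_le_maxDegree u))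
  have hdegx : (K.neighborSet x).ncard = 3 := by
    have : K.neighborSet x = G.neighborSet x \ {v} := by
      ext w
      rw [mem_neighborSet, hK, deleteEdges_adj, Set.mem_singleton_iff, Sym2.eq_swap (a := v),
        Sym2.congr_right]
      rfl
    rw [this, Set.ncard_sdiff_singleton_of_mem ((mem_neighborSet ..).2 hvx.symm), hdeg, hx]
  have hD : 4 ≤ G.maxDegree := hx ▸ G.degree_le_maxDegree x
  have hcv : ∀ c : Sym2 V → Fin (G.maxDegree + 2), colorsAt K c v = {c s(v, y), c s(v, z)} := by
    intro c
    ext d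
    simp [colorsAt, hadj, eq_comm]
  have hext : ∀ c : Sym2 V → Fin (G.maxDegree + 2), IsAcyclicEdgeColoring K c →
      ∀ j, j ∉ colorsAt K c v → j ∉ colorsAt K c x →
      ∃ a ∈ colorsAt K c v, a ∈ colorsAt K c x ∧ (bichromatic K c a j).Reachable v x := by
    intro c hc j hjv hjx
    by_contra! hr
    exact hG.1 ⟨_, hc.update hvx hjv hjx hr⟩
  have hcommon : ∀ c : Sym2 V → Fin (G.maxDegree + 2), IsAcyclicEdgeColoring K c →
      c s(v, y) ∈ colorsAt K c x ∧ c s(v, z) ∈ colorsAt K c x := by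
    intro c hc
    have hne := hN c hc
    rw [hcv] at hne
    by_cases h1 : c s(v, y) ∈ colorsAt K c x <;> by_cases h2 : c s(v, z) ∈ colorsAt K c x
    · exact ⟨h1, h2⟩
    · rw [Set.insert_inter_of_mem h1, Set.singleton_inter_eq_empty.2 h2] at hne
      simp at hne
    · rw [Set.insert_inter_of_notMem h1, Set.singleton_inter_of_mem h2] at hne
      simp at hne
    · obtain ⟨j, hj⟩ : ∃ j, j ∉ colorsAt K c v ∪ colorsAt K c x := by
        by_contra! hall
        have hle := Set.ncard_union_le (colorsAt K c v) (colorsAt K c x)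
        rw [Set.eq_univ_of_forall hall, Set.ncard_univ, Nat.card_eq_fintype_card,
          Fintype.card_fin, hc.1.ncard_colorsAt x, hdegx, hcv] at hle
        have := Set.ncard_insert_le (c s(v, y)) {c s(v, z)}
        rw [Set.ncard_singleton] at this
        omega
      rw [Set.mem_union, not_or] at hj
      obtain ⟨a, hav, hax, -⟩ := hext c hc j hj.1 hj.2
      rw [hcv] at hav
      rcases hav with rfl | rfl <;> contradiction
  have hobs : Obstructed K G.maxDegree v x y z := by
    refine ⟨hvx.ne, fun e => ?_, hyz, hadj, hdegK, hdegx, by omega, hcommon, fun c hc j hj => ?_⟩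
    · rw [hK, deleteEdges_adj] at e
      exact e.2 rfl
    · have hjv : j ∉ colorsAt K c v := by
        rw [hcv]
        rintro (rfl | rfl)
        exacts [hj (hcommon c hc).1, hj (hcommon c hc).2]
      obtain ⟨a, hav, -, hr⟩ := hext c hc j hjv hj
      rw [hcv] at hav
      rcases hav with rfl | rfl
      exacts [.inl hr, .inr hr]
  obtain ⟨c, hc⟩ := hG.2 K hlt
  exact hobs.not_isAcyclicEdgeColoring hc
end
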